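/- Let n ≥ 20 be a natural number, and let G = Sym(n) if n is even and G = Alt(n) if n is odd. Then γ(G) ≥ (n/2)·(1 − √(1 − 4/π²)) − (√17/2)·n^{3/4}. -/

import Mathlib

/-- The normal covering number of a group `G`: the least `s` such that there exist
proper subgroups `H₁, …, H_s` of `G` with every element of `G` lying in some
conjugate of some `Hᵢ`. -/
noncomputable def normalCoveringNumber (G : Type*) [Group G] : ℕ :=
  sInf {s : ℕ | ∃ H : Fin s → Subgroup G, (∀ i, H i ≠ ⊤) ∧
    ∀ g : G, ∃ i : Fin s, ∃ x : G, x * g * x⁻¹ ∈ H i}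

section

open Equiv Equiv.Perm Finset
open scoped Pointwise

/-- A permutation group is 2-homogeneous if it is transitive on unordered pairs. -/
def IsTwoHomogeneous {Ω : Type*} (L : Subgroup (Perm Ω)) : Prop :=
  ∀ a b c d : Ω, a ≠ b → c ≠ d → ∃ t ∈ L, (t a = c ∧ t b = d) ∨ (t a = d ∧ t b = c)

section Bochert

variable {Ω : Type*} [Fintype Ω] [DecidableEq Ω]

theorem commutator_ne_one_of_mem_of_notMem {x y : Perm Ω} {b : Ω}
    (h : (b ∈ y.support ∧ x b ∉ y.support) ∨ (b ∉ y.support ∧ x b ∈ y.support)) :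
    x * y * x⁻¹ * y⁻¹ ≠ 1 := by
  intro h1
  have h2 : x * y = y * x := by
    have := congrArg (fun z => z * y * x) h1
    simpa [mul_assoc] using this
  have h3 : x (y b) = y (x b) := by simpa using DFunLike.congr_fun h2 b
  simp only [mem_support, not_not] at h
  rcases h with ⟨hb, hxb⟩ | ⟨hb, hxb⟩
  · rw [hxb] at h3
    exact hb (x.injective h3)
  · rw [hb] at h3
    exact hxb h3.symm

theorem card_support_commutator_le (x y : Perm Ω) :
    #(x * y * x⁻¹ * y⁻¹).support ≤ 3 * #(x.support ∩ y.support) := by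
  set I := x.support ∩ y.support with hI
  have hsub : (x * y * x⁻¹ * y⁻¹).support ⊆ I ∪ (I.image x ∪ I.image y) := by
    intro c hc
    by_contra hn
    simp only [mem_union, not_or, mem_image, not_exists, not_and, hI, mem_inter,
      mem_support] at hn
    obtain ⟨h1, h2, h3⟩ := hn
    apply mem_support.mp hc
    have e : x⁻¹ (y⁻¹ c) = y⁻¹ (x⁻¹ c) := by
      have hx := h2 (x⁻¹ c)
      have hy := h3 (y⁻¹ c)
      have kx' : x (x⁻¹ c) = c := by simp
      have ky' : y (y⁻¹ c) = c := by simp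
      have kx : ∀ z, x⁻¹ z = z ↔ x z = z := fun z => by
        rw [Perm.inv_eq_iff_eq, eq_comm]
      have ky : ∀ z, y⁻¹ z = z ↔ y z = z := fun z => by
        rw [Perm.inv_eq_iff_eq, eq_comm]
      grind
    simp only [Perm.mul_apply, e]
    simp
  calc _ ≤ _ := card_le_card hsub
    _ ≤ #I + (#(I.image x) + #(I.image y)) :=
      (card_union_le _ _).trans (by gcongr; exact card_union_le _ _)
    _ ≤ #I + (#I + #I) := by
      have hx := card_image_le (s := I) (f := x)
      have hy := card_image_le (s := I) (f := y)
      omega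
    _ = _ := by ring

theorem isThreeCycle_commutator {x y : Perm Ω} (h : #(x.support ∩ y.support) ≤ 1)
    (h1 : x * y * x⁻¹ * y⁻¹ ≠ 1) : (x * y * x⁻¹ * y⁻¹).IsThreeCycle := by
  rw [← card_support_eq_three_iff]
  have hle := card_support_commutator_le x y
  have h2 : 2 ≤ #(x * y * x⁻¹ * y⁻¹).support := two_le_card_support_of_ne_one h1
  have hne : #(x * y * x⁻¹ * y⁻¹).support ≠ 2 := by
    intro h2
    have hs := (card_support_eq_two.mp h2).sign_eq
    simp only [map_mul, sign_inv] at hs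
    rcases Int.units_eq_one_or (sign x) with h | h <;>
      rcases Int.units_eq_one_or (sign y) with h' | h' <;> rw [h, h'] at hs <;> simp at hs
  omega

theorem sum_sum_ite_eq_zero (F : Ω → Ω → ℝ) : (∑ c, ∑ d, if c = d then 0 else F c d) =
    ∑ c, ∑ d, F c d - ∑ c, F c c := by
  rw [← sum_sub_distrib]
  refine sum_congr rfl fun c _ => ?_
  have h2 : ∀ d, (if c = d then 0 else F c d) = F c d - if c = d then F c d else 0 := fun d => by
    split_ifs <;> simp
  simp only [h2, sum_sub_distrib, sum_ite_eq, mem_univ, if_true]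

variable {L : Subgroup (Perm Ω)} [Fintype L]

theorem card_mul_sum_apply {Ω : Type*} [Fintype Ω] {L : Subgroup (Perm Ω)} [Fintype L]
    (ht : ∀ a b, ∃ t ∈ L, t a = b) (f : Ω → ℝ) (b : Ω) :
    Fintype.card Ω * ∑ t : L, f (t.1 b) = Fintype.card L * ∑ c, f c := by
  have h1 : ∀ c, ∑ t : L, f (t.1 c) = ∑ t : L, f (t.1 b) := by
    intro c
    obtain ⟨u, hu, rfl⟩ := ht b c
    exact Fintype.sum_equiv (Equiv.mulRight (⟨u, hu⟩ : L)) _ _ (fun t => rfl)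
  calc _ = ∑ c, ∑ t : L, f (t.1 c) := by simp [h1]
    _ = ∑ t : L, ∑ c, f (t.1 c) := sum_comm
    _ = ∑ t : L, ∑ c, f c := sum_congr rfl fun t _ => Equiv.sum_comp t.1 f
    _ = _ := by simp

theorem card_mul_sum_apply_apply (h : IsTwoHomogeneous L) (F : Ω → Ω → ℝ)
    (hF : ∀ a b, F a b = F b a) {a b : Ω} (hab : a ≠ b) :
    (Fintype.card Ω * (Fintype.card Ω - 1) : ℝ) * ∑ t : L, F (t.1 a) (t.1 b) =
      Fintype.card L * ∑ c, ∑ d, if c = d then 0 else F c d := by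
  have h1 : ∀ c d, c ≠ d → ∑ t : L, F (t.1 c) (t.1 d) = ∑ t : L, F (t.1 a) (t.1 b) := by
    intro c d hcd
    obtain ⟨u, hu, ⟨rfl, rfl⟩ | ⟨rfl, rfl⟩⟩ := h a b c d hab hcd
    · exact Fintype.sum_equiv (Equiv.mulRight (⟨u, hu⟩ : L)) _ _ (fun t => rfl)
    · exact Fintype.sum_equiv (Equiv.mulRight (⟨u, hu⟩ : L)) _ _ (fun t => hF _ _)
  calc _ = ∑ c : Ω, ∑ d : Ω, if c = d then 0 else ∑ t : L, F (t.1 a) (t.1 b) := by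
        rw [sum_sum_ite_eq_zero (fun _ _ => ∑ t : L, F (t.1 a) (t.1 b))]
        simp only [sum_const, card_univ, nsmul_eq_mul]
        ring
    _ = ∑ c : Ω, ∑ d : Ω, ∑ t : L, if c = d then 0 else F (t.1 c) (t.1 d) := by
        refine sum_congr rfl fun c _ => sum_congr rfl fun d _ => ?_
        split_ifs with hcd
        · simp
        · exact (h1 c d hcd).symm
    _ = ∑ t : L, ∑ c, ∑ d, if c = d then 0 else F (t.1 c) (t.1 d) := by
        rw [sum_comm (s := (univ : Finset L))]
        exact sum_congr rfl fun c _ => sum_comm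
    _ = ∑ t : L, ∑ c, ∑ d, if c = d then 0 else F c d := by
        refine sum_congr rfl fun t _ => ?_
        rw [← Equiv.sum_comp t.1 (fun c => ∑ d, if c = d then 0 else F c d)]
        refine sum_congr rfl fun c _ => ?_
        rw [← Equiv.sum_comp t.1 (fun d => if t.1 c = d then 0 else F (t.1 c) d)]
        simp
    _ = _ := by simp

theorem mul_sub_sq_le {d i μ θ : ℝ} (hμ : 0 ≤ μ) (hμθ : μ ≤ θ) (hi : θ ≤ i) (hd : d ≤ 2 * i) :
    d * (θ - μ) ^ 2 ≤ 2 * θ * (i - μ) ^ 2 := by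
  have h1 : 0 ≤ (i - θ) * (θ * i - μ ^ 2) := mul_nonneg (by linarith) (by nlinarith)
  have h2 := mul_le_mul_of_nonneg_right hd (sq_nonneg (θ - μ))
  linarith

theorem le_of_variance_le {l a N μ : ℝ} (hl : 0 < l) (ha : 0 < a) (hN : 0 < N)
    (hμ : μ * N = a ^ 2)
    (h : l * (a * (2 * a * (N - a))) * (a / 3 - μ) ^ 2 ≤ 2 * (a / 3) * (l * (a ^ 2 * (N - 1)))) :
    a * (N - a) * (N - 3 * a) ^ 2 ≤ 3 * N ^ 2 * (N - 1) := by
  have e : (a / 3 - μ) ^ 2 * (9 * N ^ 2) = a ^ 2 * (N - 3 * a) ^ 2 := by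
    linear_combination (9 * (μ * N + a ^ 2) - 6 * a * N) * hμ
  refine le_of_mul_le_mul_left ?_ (by positivity : 0 < l * (2 * a ^ 3))
  calc l * (2 * a ^ 3) * (a * (N - a) * (N - 3 * a) ^ 2) =
      l * (a * (2 * a * (N - a))) * (a / 3 - μ) ^ 2 * (9 * N ^ 2) := by
        linear_combination (-l * (a * (2 * a * (N - a)))) * e
    _ ≤ 2 * (a / 3) * (l * (a ^ 2 * (N - 1))) * (9 * N ^ 2) :=
      mul_le_mul_of_nonneg_right h (by positivity)
    _ = _ := by ring

theorem mem_support_inv_mul_mul {x t : Perm Ω} {b : Ω} :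
    b ∈ (t⁻¹ * x * t).support ↔ t b ∈ x.support := by
  simp only [mem_support, Perm.mul_apply, ne_eq, Perm.inv_eq_iff_eq]

theorem exists_isThreeCycle_or_le (ht : ∀ a b, ∃ t ∈ L, t a = b) (h : IsTwoHomogeneous L)
    (hn : 2 ≤ Fintype.card Ω) {x : Perm Ω} (hx : x ∈ L) (hx1 : x ≠ 1)
    (hmin : ∀ y ∈ L, y ≠ 1 → #x.support ≤ #y.support) (h3 : 3 * #x.support ≤ Fintype.card Ω) :
    (∃ z ∈ L, z.IsThreeCycle) ∨ ((Fintype.card Ω : ℝ) - 1 ≤ (#x.support - 1 : ℝ) ^ 2 ∧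
      (#x.support : ℝ) * (Fintype.card Ω - #x.support) *
        (Fintype.card Ω - 3 * #x.support) ^ 2 ≤ 3 * Fintype.card Ω ^ 2 * (Fintype.card Ω - 1)) := by
  set χ : Ω → ℝ := fun c => if c ∈ x.support then 1 else 0 with hχ
  set a : ℝ := (#x.support : ℝ) with ha
  set N : ℝ := (Fintype.card Ω : ℝ) with hN
  have hN2 : (2 : ℝ) ≤ N := by rw [hN]; exact_mod_cast hn
  have hsum : ∑ c, χ c = a := by simp only [hχ, ha, sum_boole, filter_mem_eq_inter, univ_inter]
  have hχ0 : ∀ c, 0 ≤ χ c := fun c => by simp only [hχ]; split_ifs <;> norm_num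
  have hχ1 : ∀ c, χ c ≤ 1 := fun c => by simp only [hχ]; split_ifs <;> norm_num
  have hχχ : ∀ c, χ c * χ c = χ c := fun c => by simp only [hχ]; split_ifs <;> norm_num
  have hχx : ∀ c, χ (x c) = χ c := fun c => by simp only [hχ, apply_mem_support]
  set I : L → ℝ := fun t => ∑ b, χ b * χ (t.1 b) with hI
  set D : L → ℝ := fun t => ∑ b, χ b *
    (χ (t.1 b) * (1 - χ (t.1 (x b))) + χ (t.1 (x b)) * (1 - χ (t.1 b))) with hD
  have S1 : N * ∑ t, I t = Fintype.card L * (a * a) := by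
    simp only [hI]
    rw [sum_comm, mul_sum]
    have e : ∀ b, N * ∑ t : L, χ b * χ (t.1 b) = χ b * (Fintype.card L * a) := fun b => by
      rw [← mul_sum, mul_left_comm, card_mul_sum_apply ht χ, hsum]
    simp_rw [e]
    rw [← sum_mul, hsum]
    ring
  have S2 : N * (N - 1) * ∑ t, (I t ^ 2 - I t) = Fintype.card L * (a ^ 2 - a) * (a ^ 2 - a) := by
    have e : ∀ t : L, I t ^ 2 - I t =
        ∑ c, ∑ d, if c = d then 0 else χ c * χ d * (χ (t.1 c) * χ (t.1 d)) := by
      intro t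
      rw [sum_sum_ite_eq_zero]
      simp only [hI]
      rw [sq, sum_mul_sum]
      congr 1
      · exact sum_congr rfl fun c _ => sum_congr rfl fun d _ => by ring
      · exact sum_congr rfl fun c _ => by rw [hχχ, hχχ]
    have e2 : (∑ c, ∑ d, if c = d then 0 else χ c * χ d) = a ^ 2 - a := by
      rw [sum_sum_ite_eq_zero]
      simp only [hχχ, hsum, ← sum_mul_sum, sq]
    simp_rw [e]
    rw [sum_comm, mul_sum]
    have e3 : ∀ c, N * (N - 1) * ∑ t : L, (∑ d, if c = d then 0 else
        χ c * χ d * (χ (t.1 c) * χ (t.1 d))) =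
        ∑ d, if c = d then 0 else χ c * χ d * (Fintype.card L * (a ^ 2 - a)) := by
      intro c
      rw [sum_comm, mul_sum]
      refine sum_congr rfl fun d _ => ?_
      split_ifs with hcd
      · simp
      · rw [← mul_sum, mul_left_comm, card_mul_sum_apply_apply h (fun c d => χ c * χ d)
          (fun _ _ => mul_comm _ _) hcd, e2]
    simp_rw [e3]
    rw [sum_sum_ite_eq_zero]
    simp only [hχχ, ← sum_mul, ← mul_sum, hsum]
    ring
  have S3 : N * (N - 1) * ∑ t, D t = Fintype.card L * (a * (2 * a * (N - a))) := by
    simp only [hD]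
    rw [sum_comm, mul_sum]
    have e2 : (∑ c, ∑ d, if c = d then 0 else χ c * (1 - χ d) + χ d * (1 - χ c)) =
        2 * a * (N - a) := by
      rw [sum_sum_ite_eq_zero]
      have : ∀ c, χ c * (1 - χ c) + χ c * (1 - χ c) = 0 := fun c => by
        linear_combination -2 * hχχ c
      simp only [this, sum_const_zero]
      simp only [mul_sub, sum_add_distrib, sum_sub_distrib, mul_one,
        ← sum_mul, ← mul_sum, hsum, sum_const, card_univ, nsmul_eq_mul]
      simp only [← hN]
      ring
    have e3 : ∀ c, N * (N - 1) * ∑ t : L, χ c *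
        (χ (t.1 c) * (1 - χ (t.1 (x c))) + χ (t.1 (x c)) * (1 - χ (t.1 c))) =
        χ c * (Fintype.card L * (2 * a * (N - a))) := by
      intro c
      by_cases hc : c ∈ x.support
      · rw [← mul_sum, mul_left_comm, card_mul_sum_apply_apply h
          (fun c d => χ c * (1 - χ d) + χ d * (1 - χ c)) (fun _ _ => add_comm _ _)
          (mem_support.mp hc).symm, e2]
      · simp only [hχ, hc, if_false, zero_mul, sum_const_zero, mul_zero]
    simp_rw [e3]
    rw [← sum_mul, hsum]
    ring
  have hDI : ∀ t, D t ≤ 2 * I t := by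
    intro t
    have e1 : I t = ∑ b, χ b * χ (t.1 (x b)) := by
      simp only [hI]
      rw [← Equiv.sum_comp x (fun b => χ b * χ (t.1 b))]
      simp only [hχx]
    have : 2 * I t = ∑ b, χ b * (χ (t.1 b) + χ (t.1 (x b))) := by
      rw [two_mul]
      nth_rewrite 2 [e1]
      simp only [hI, mul_add, sum_add_distrib]
    rw [this]
    refine sum_le_sum fun b _ => mul_le_mul_of_nonneg_left ?_ (hχ0 b)
    nlinarith [mul_nonneg (hχ0 (t.1 b)) (hχ0 (t.1 (x b)))]
  have hIcard : ∀ t : L, I t = (#(x.support ∩ (t.1⁻¹ * x * t.1).support) : ℝ) := by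
    intro t
    have : x.support ∩ (t.1⁻¹ * x * t.1).support =
        univ.filter fun b => b ∈ x.support ∧ t.1 b ∈ x.support := by
      ext b
      simp only [mem_inter, mem_support_inv_mul_mul, mem_filter, mem_univ, true_and]
    rw [this, natCast_card_filter]
    refine sum_congr rfl fun b _ => ?_
    simp only [hχ, ite_and, ite_mul, one_mul, zero_mul]
  have hne : ∀ t : L, D t ≠ 0 → x * (t.1⁻¹ * x * t.1) * x⁻¹ * (t.1⁻¹ * x * t.1)⁻¹ ≠ 1 := by
    intro t hDt
    obtain ⟨b, -, hb⟩ := exists_ne_zero_of_sum_ne_zero hDt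
    apply commutator_ne_one_of_mem_of_notMem (b := b)
    simp only [mem_support_inv_mul_mul]
    by_contra hcon
    apply hb
    have : t.1 b ∈ x.support ↔ t.1 (x b) ∈ x.support := by tauto
    simp only [hχ, this]
    split_ifs <;> ring
  have hmemL : ∀ t : L, x * (t.1⁻¹ * x * t.1) * x⁻¹ * (t.1⁻¹ * x * t.1)⁻¹ ∈ L := by
    intro t
    have : t.1⁻¹ * x * t.1 ∈ L := L.mul_mem (L.mul_mem (L.inv_mem t.2) hx) t.2
    exact L.mul_mem (L.mul_mem (L.mul_mem hx this) (L.inv_mem hx)) (L.inv_mem this)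
  have hL : (0 : ℝ) < Fintype.card L := by exact_mod_cast Fintype.card_pos
  have ha0 : 0 < a := by
    rw [ha, Nat.cast_pos, card_pos, nonempty_iff_ne_empty, ne_eq, support_eq_empty_iff]
    exact hx1
  have h3a : 3 * a ≤ N := by rw [ha, hN]; exact_mod_cast h3
  by_cases hsmall : (a - 1) ^ 2 < N - 1
  · left
    have hpos : 0 < ∑ t, (I t - (I t ^ 2 - I t)) := by
      rw [sum_sub_distrib]
      have : 0 < N * (N - 1) * (∑ t, I t - ∑ t, (I t ^ 2 - I t)) := by
        have : N * (N - 1) * (∑ t, I t - ∑ t, (I t ^ 2 - I t)) =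
            Fintype.card L * (a ^ 2 * ((N - 1) - (a - 1) ^ 2)) := by
          linear_combination (N - 1) * S1 - S2
        rw [this]
        have := sub_pos.mpr hsmall
        positivity
      exact pos_of_mul_pos_right this (by nlinarith)
    obtain ⟨t, -, ht0⟩ := exists_lt_of_sum_lt (by simpa using hpos :
      ∑ t : L, (0 : ℝ) < ∑ t, (I t - (I t ^ 2 - I t)))
    have hI1 : #(x.support ∩ (t.1⁻¹ * x * t.1).support) = 1 := by
      rw [hIcard t] at ht0
      set k := #(x.support ∩ (t.1⁻¹ * x * t.1).support)
      have hk : (k : ℝ) * (2 - k) > 0 := by linarith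
      have h1 : 0 < k := by
        rcases Nat.eq_zero_or_pos k with h0 | h0
        · simp [h0] at hk
        · exact h0
      have h2 : (k : ℝ) < 2 := by
        by_contra! hge
        nlinarith
      have : k < 2 := by exact_mod_cast h2
      omega
    refine ⟨_, hmemL t, isThreeCycle_commutator hI1.le ?_⟩
    obtain ⟨b, hb⟩ := card_eq_one.mp hI1
    have hb' : ∀ c, (c ∈ x.support ∧ c ∈ (t.1⁻¹ * x * t.1).support) ↔ c = b := fun c => by
      rw [← mem_inter, hb, mem_singleton]
    have h1 := (hb' b).mpr rfl
    refine commutator_ne_one_of_mem_of_notMem (b := b) (Or.inl ⟨h1.2, fun hxb => ?_⟩)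
    exact mem_support.mp h1.1 ((hb' (x b)).mp ⟨apply_mem_support.mpr h1.1, hxb⟩)
  · right
    refine ⟨not_lt.mp hsmall, ?_⟩
    set μ := a ^ 2 / N with hμ
    have hμN : μ * N = a ^ 2 := by rw [hμ]; field_simp
    have hμθ : μ ≤ a / 3 := by rw [hμ, div_le_iff₀ (by linarith)]; nlinarith
    have hpt : ∀ t, D t * (a / 3 - μ) ^ 2 ≤ 2 * (a / 3) * (I t - μ) ^ 2 := by
      intro t
      by_cases hDt : D t = 0
      · rw [hDt, zero_mul]; positivity
      · have h1 := (hmin _ (hmemL t) (hne t hDt)).trans (card_support_commutator_le _ _)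
        have h2 : a ≤ 3 * I t := by rw [hIcard t, ha]; exact_mod_cast h1
        exact mul_sub_sq_le (by positivity) hμθ (by linarith) (hDI t)
    have hsumle := sum_le_sum fun t (_ : t ∈ (univ : Finset L)) => hpt t
    rw [← sum_mul, ← mul_sum] at hsumle
    have hvar : N * (N - 1) * ∑ t, (I t - μ) ^ 2 ≤ Fintype.card L * (a ^ 2 * (N - 1)) := by
      have e : ∑ t, (I t - μ) ^ 2 =
          ∑ t, (I t ^ 2 - I t) + (1 - 2 * μ) * ∑ t, I t + Fintype.card L * μ ^ 2 := by
        rw [mul_sum, ← sum_add_distrib]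
        have : (Fintype.card L * μ ^ 2 : ℝ) = ∑ t : L, μ ^ 2 := by simp
        rw [this, ← sum_add_distrib]
        exact sum_congr rfl fun t _ => by ring
      have e2 : N * (N - 1) * ∑ t, (I t - μ) ^ 2 = Fintype.card L *
          (a ^ 2 * ((a - 1) ^ 2 + (N - 1) - (N - 1) * μ)) := by
        rw [e]
        linear_combination S2 + (N - 1) * (1 - 2 * μ) * S1 + Fintype.card L * (N - 1) * μ * hμN
      rw [e2]
      have : (a - 1) ^ 2 ≤ (N - 1) * μ := by
        have ha1 : 1 ≤ a := by rw [ha] at ha0 ⊢; exact_mod_cast ha0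
        rw [hμ, mul_div_assoc', le_div_iff₀ (by linarith)]
        have h1 := mul_nonneg ha0.le (by linarith : 0 ≤ N - a)
        have h2 := mul_nonneg (by linarith : 0 ≤ N) (by linarith : 0 ≤ a - 1)
        linarith
      refine mul_le_mul_of_nonneg_left (mul_le_mul_of_nonneg_left ?_ (sq_nonneg a)) hL.le
      linarith
    have hfin : Fintype.card L * (a * (2 * a * (N - a))) * (a / 3 - μ) ^ 2 ≤
        2 * (a / 3) * (Fintype.card L * (a ^ 2 * (N - 1))) := by
      rw [← S3]
      have hNN : 0 ≤ N * (N - 1) := mul_nonneg (by linarith) (by linarith)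
      calc _ = N * (N - 1) * ((∑ t, D t) * (a / 3 - μ) ^ 2) := by ring
        _ ≤ N * (N - 1) * (2 * (a / 3) * ∑ t, (I t - μ) ^ 2) :=
          mul_le_mul_of_nonneg_left hsumle hNN
        _ = 2 * (a / 3) * (N * (N - 1) * ∑ t, (I t - μ) ^ 2) := by ring
        _ ≤ _ := mul_le_mul_of_nonneg_left hvar (by positivity)
    exact le_of_variance_le hL ha0 (by linarith) hμN hfin

theorem IsTwoHomogeneous.isPreprimitive {Ω : Type*} {L : Subgroup (Perm Ω)}
    (h : IsTwoHomogeneous L) (ht : ∀ a b, ∃ t ∈ L, t a = b) : MulAction.IsPreprimitive L Ω := by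
  have : MulAction.IsPretransitive L Ω := ⟨fun a b => by
    obtain ⟨t, htL, hab⟩ := ht a b
    exact ⟨⟨t, htL⟩, hab⟩⟩
  refine ⟨fun {B} hB => ?_⟩
  by_contra hcon
  simp only [MulAction.IsTrivialBlock, not_or, Set.Subsingleton, not_forall] at hcon
  obtain ⟨⟨a, ha, b, hb, hab⟩, huniv⟩ := hcon
  obtain ⟨c, hc⟩ := (Set.ne_univ_iff_exists_notMem B).mp huniv
  have hac : a ≠ c := fun e => hc (e ▸ ha)
  obtain ⟨t, htL, h1 | h1⟩ := h a b a c hab hac <;>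
  · have hmem : ∀ z ∈ B, t z ∈ (⟨t, htL⟩ : L) • B := fun z hz => Set.smul_mem_smul_set hz
    have hB' : (⟨t, htL⟩ : L) • B = B := by
      apply MulAction.isBlock_iff_smul_eq_of_nonempty.mp hB
      first
      | exact ⟨a, h1.1 ▸ hmem a ha, ha⟩
      | exact ⟨a, h1.2 ▸ hmem b hb, ha⟩
    rw [hB'] at hmem
    first
    | exact hc (h1.2 ▸ hmem b hb)
    | exact hc (h1.1 ▸ hmem a ha)

/-- A 2-homogeneous permutation group containing an element of small support contains the
alternating group. -/
theorem IsTwoHomogeneous.alternatingGroup_le {L : Subgroup (Perm Ω)} (h : IsTwoHomogeneous L)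
    (ht : ∀ a b, ∃ t ∈ L, t a = b) (hn : 100000 ≤ Fintype.card Ω) {g : Perm Ω} (hg : g ∈ L)
    (hg1 : g ≠ 1) (hgn : 25 * #g.support ≤ 8 * Fintype.card Ω) : alternatingGroup Ω ≤ L := by
  classical
  have : Fintype L := Fintype.ofFinite L
  obtain ⟨x, hx, hmin⟩ := exists_min_image (univ.filter fun y : Perm Ω => y ∈ L ∧ y ≠ 1)
    (fun y => #y.support) ⟨g, by simp [hg, hg1]⟩
  simp only [mem_filter, mem_univ, true_and] at hx hmin
  have hxn : 25 * #x.support ≤ 8 * Fintype.card Ω :=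
    (Nat.mul_le_mul_left 25 (hmin g ⟨hg, hg1⟩)).trans hgn
  obtain ⟨z, hz, hz3⟩ | ⟨h1, h2⟩ := exists_isThreeCycle_or_le ht h (by omega) hx.1 hx.2
    (fun y hy hy1 => hmin y ⟨hy, hy1⟩) (by omega)
  · exact alternatingGroup_le_of_isPreprimitive_of_isThreeCycle_mem (h.isPreprimitive ht) hz3 hz
  · exfalso
    have hN : (100000 : ℝ) ≤ Fintype.card Ω := by exact_mod_cast hn
    have ha : 25 * (#x.support : ℝ) ≤ 8 * Fintype.card Ω := by exact_mod_cast hxn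
    have ha1 : (2 : ℝ) ≤ #x.support := by exact_mod_cast two_le_card_support_of_ne_one hx.2
    generalize (Fintype.card Ω : ℝ) = N at *
    generalize (#x.support : ℝ) = a at *
    have ha300 : 300 ≤ a := by nlinarith
    have : 3 * N ^ 3 < a * (N - a) * (N - 3 * a) ^ 2 := by
      by_cases hc : 10 * a ≤ N
      · calc 3 * N ^ 3 < 300 * (9 / 10 * N) * (7 / 10 * N) ^ 2 := by
              have : 0 < N ^ 3 := by positivity
              nlinarith
          _ ≤ _ := by
              have : 0 ≤ a * (N - a) := mul_nonneg (by linarith) (by linarith)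
              gcongr <;> linarith
      · calc 3 * N ^ 3 < 10000 * (68 / 100 * N) * (4 / 100 * N) ^ 2 := by
              have : 0 < N ^ 3 := by positivity
              nlinarith
          _ ≤ _ := by
              have : 0 ≤ a * (N - a) := mul_nonneg (by linarith) (by linarith)
              gcongr <;> linarith
    nlinarith [sq_nonneg N]

end Bochert

end

section

open Finset Equiv

section Projection

variable {Ω : Type*} [Fintype Ω] [DecidableEq Ω] {P : Ω → Ω → ℝ}

/-- `P` is a symmetric idempotent matrix with constant diagonal `τ`. -/
structure IsConstDiagProj (P : Ω → Ω → ℝ) (τ : ℝ) : Prop where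
  symm : ∀ a b, P a b = P b a
  idem : ∀ a b, ∑ x, P x a * P x b = P a b
  diag : ∀ a, P a a = τ

namespace IsConstDiagProj

variable {τ : ℝ}

theorem sum_mul_sum {Ω : Type*} [Fintype Ω] {P : Ω → Ω → ℝ} {τ : ℝ}
    (hP : IsConstDiagProj P τ) (S : Finset Ω) (a : Ω) :
    ∑ x, P x a * ∑ s ∈ S, P x s = ∑ s ∈ S, P a s := by
  simp_rw [mul_sum]
  rw [sum_comm]
  exact sum_congr rfl fun s _ => hP.idem a s

theorem sum_sum_mul_sum {Ω : Type*} [Fintype Ω] {P : Ω → Ω → ℝ} {τ : ℝ}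
    (hP : IsConstDiagProj P τ) (S T : Finset Ω) :
    ∑ x, (∑ s ∈ S, P x s) * ∑ t ∈ T, P x t = ∑ s ∈ S, ∑ t ∈ T, P s t := by
  simp_rw [sum_mul]
  rw [sum_comm]
  exact sum_congr rfl fun s _ => hP.sum_mul_sum T s

theorem four_mul_sq_mul_le (hP : IsConstDiagProj P τ) {S T : Finset Ω} (hd : Disjoint S T) {p : ℝ}
    (hp : ∀ s ∈ S, ∀ t ∈ T, P s t = p) (hS : S.Nonempty) :
    4 * p ^ 2 * (#S * #T) ≤ 1 := by
  set w : Ω → ℝ := fun x => ∑ s ∈ S, P x s with hw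
  have h1 : ∑ x, (2 * w x - if x ∈ S then 1 else (0 : ℝ)) ^ 2 = (#S : ℝ) := by
    have e : ∀ x, (2 * w x - if x ∈ S then 1 else (0 : ℝ)) ^ 2 =
        4 * (w x * w x) - (if x ∈ S then 4 * w x else 0) + if x ∈ S then 1 else 0 := fun x => by
      split_ifs <;> ring
    rw [sum_congr rfl fun x _ => e x, sum_add_distrib, sum_sub_distrib, ← mul_sum,
      hP.sum_sum_mul_sum]
    simp [← mul_sum, hw]
  have h2 : ∑ x ∈ T, (2 * w x - if x ∈ S then 1 else (0 : ℝ)) ^ 2 = #T * (4 * #S ^ 2 * p ^ 2) := by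
    rw [← nsmul_eq_mul, ← sum_const]
    refine sum_congr rfl fun x hx => ?_
    have hxS : x ∉ S := fun h => disjoint_left.mp hd h hx
    have : w x = #S * p := by
      rw [hw, ← nsmul_eq_mul, ← sum_const]
      exact sum_congr rfl fun s hs => by rw [hP.symm, hp s hs x hx]
    rw [this, if_neg hxS]
    ring
  have h3 := sum_le_sum_of_subset_of_nonneg (subset_univ T)
    (fun x _ _ => sq_nonneg (2 * w x - if x ∈ S then 1 else 0))
  rw [h1, h2] at h3
  have hS0 : (0 : ℝ) < #S := by exact_mod_cast hS.card_pos
  refine le_of_mul_le_mul_left ?_ hS0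
  linarith

theorem sq_le_mul_sub {Ω : Type*} [Fintype Ω] {P : Ω → Ω → ℝ} {τ : ℝ}
    (hP : IsConstDiagProj P τ) {S : Finset Ω} (hS : S.Nonempty) {c : ℝ}
    (hc : ∀ s ∈ S, ∑ t ∈ S, P s t = c) :
    (#S * τ - c) ^ 2 ≤ Fintype.card Ω * τ * (∑ s ∈ S, ∑ t ∈ S, P s t ^ 2 - c ^ 2) := by
  have hS0 : (#S : ℝ) ≠ 0 := by exact_mod_cast hS.card_pos.ne'
  set w : Ω → ℝ := fun x => ∑ s ∈ S, P x s with hw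
  set g : Ω → Ω → ℝ := fun s y => P y s - w y / #S with hg
  have hPg : ∀ s ∈ S, ∀ a, ∑ y, P y a * g s y = P a s - w a / #S := by
    intro s _ a
    simp only [hg, mul_sub, sum_sub_distrib, hP.idem, ← mul_div_assoc, ← sum_div, hw,
      hP.sum_mul_sum]
  have hgg : ∀ s ∈ S, ∀ t ∈ S, ∑ y, g s y * g t y = P s t - c / #S := by
    intro s hs t ht
    have e : ∀ y, g s y * g t y = P y s * g t y - (w y * P y t) / #S + (w y * w y) / #S / #S :=
      fun y => by simp only [hg]; ring
    have e2 : ∑ y, w y * P y t = c := by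
      simp_rw [mul_comm (w _)]
      rw [hw, hP.sum_mul_sum, hc t ht]
    have e3 : ∑ y, w y * w y = #S * c := by
      rw [hw, hP.sum_sum_mul_sum, sum_congr rfl hc, sum_const, nsmul_eq_mul]
    simp only [e, sum_add_distrib, sum_sub_distrib, ← sum_div, e2, e3, hPg t ht]
    simp only [hw, hc s hs]
    field_simp
    ring
  have h1 : ∑ x : Ω × Ω, P x.1 x.2 * ∑ s ∈ S, P x.1 s * g s x.2 = #S * τ - c := by
    rw [Fintype.sum_prod_type]
    have e : ∀ s ∈ S, ∑ x, ∑ y, P x y * (P x s * g s y) = τ - c / #S := by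
      intro s hs
      rw [sum_comm]
      have e' : ∀ y, ∑ x, P x y * (P x s * g s y) = P y s * g s y := fun y => by
        simp_rw [← mul_assoc, ← sum_mul, hP.idem]
      simp only [e', hPg s hs, hP.diag]
      simp only [hw, hc s hs]
    simp_rw [mul_sum]
    calc _ = ∑ x, ∑ s ∈ S, ∑ y, P x y * (P x s * g s y) := sum_congr rfl fun x _ => sum_comm
      _ = ∑ s ∈ S, ∑ x, ∑ y, P x y * (P x s * g s y) := sum_comm
      _ = _ := by
        rw [sum_congr rfl e, sum_const, nsmul_eq_mul]
        field_simp
  have h2 : ∑ x : Ω × Ω, P x.1 x.2 ^ 2 = Fintype.card Ω * τ := by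
    rw [Fintype.sum_prod_type, sum_comm]
    simp_rw [sq, hP.idem, hP.diag]
    simp
  have h3 : ∑ x : Ω × Ω, (∑ s ∈ S, P x.1 s * g s x.2) ^ 2 =
      ∑ s ∈ S, ∑ t ∈ S, P s t ^ 2 - c ^ 2 := by
    rw [Fintype.sum_prod_type]
    have e : ∀ s ∈ S, ∀ t ∈ S, ∑ x, ∑ y, (P x s * g s y) * (P x t * g t y) =
        P s t * (P s t - c / #S) := by
      intro s hs t ht
      rw [← hgg s hs t ht, ← hP.idem, Finset.sum_mul_sum]
      exact sum_congr rfl fun x _ => sum_congr rfl fun y _ => by ring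
    simp_rw [sq (∑ s ∈ S, _), Finset.sum_mul_sum]
    calc _ = ∑ x, ∑ s ∈ S, ∑ t ∈ S, ∑ y, (P x s * g s y) * (P x t * g t y) := by
          refine sum_congr rfl fun x _ => ?_
          rw [sum_comm]
          exact sum_congr rfl fun s _ => sum_comm
      _ = ∑ s ∈ S, ∑ t ∈ S, ∑ x, ∑ y, (P x s * g s y) * (P x t * g t y) := by
          rw [sum_comm]
          exact sum_congr rfl fun s _ => sum_comm
      _ = ∑ s ∈ S, ∑ t ∈ S, P s t * (P s t - c / #S) :=
          sum_congr rfl fun s hs => sum_congr rfl fun t ht => e s hs t ht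
      _ = _ := by
          simp only [mul_sub, sum_sub_distrib, ← sum_mul, sq]
          rw [sum_congr rfl hc, sum_const, nsmul_eq_mul]
          field_simp
  rw [← h1, ← h2, ← h3]
  exact sum_mul_sq_le_sq_mul_sq _ _ _

theorem card_sub_two_le (hP : IsConstDiagProj P τ) {S : Finset Ω} (hS : S.Nonempty) {c q : ℝ}
    (hc : ∀ s ∈ S, ∑ t ∈ S, P s t = c) (hq : ∀ a b, a ≠ b → P a b ≤ q) (hqτ : q < τ)
    (hqc : #S * q ≤ c) (hτ0 : 0 ≤ τ) : (#S : ℝ) - 2 ≤ 2 * Fintype.card Ω * τ := by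
  have h := hP.sq_le_mul_sub hS hc
  have hm : (1 : ℝ) ≤ #S := by exact_mod_cast hS.card_pos
  have hrow : ∀ s ∈ S, ∑ t ∈ S.erase s, (q - P s t) = τ + (#S - 1) * q - c := by
    intro s hs
    rw [sum_sub_distrib, sum_const, card_erase_of_mem hs, nsmul_eq_mul,
      Nat.cast_sub hS.card_pos, ← hc s hs, ← add_sum_erase _ _ hs, hP.diag]
    push_cast
    ring
  have hs0 : 0 ≤ τ + (#S - 1) * q - c := by
    obtain ⟨s, hs⟩ := hS
    rw [← hrow s hs]
    exact sum_nonneg fun t ht => sub_nonneg.mpr (hq s t (ne_of_mem_erase ht).symm)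
  have hsq : ∀ s ∈ S, ∑ t ∈ S, (q - P s t) ^ 2 ≤ 2 * (τ - q) ^ 2 := by
    intro s hs
    rw [← add_sum_erase _ _ hs, hP.diag]
    have h1 : ∑ t ∈ S.erase s, (q - P s t) ^ 2 ≤ (∑ t ∈ S.erase s, (q - P s t)) ^ 2 :=
      sum_sq_le_sq_sum_of_nonneg fun t ht => sub_nonneg.mpr (hq s t (ne_of_mem_erase ht).symm)
    rw [hrow s hs] at h1
    nlinarith
  have hsum : ∑ s ∈ S, ∑ t ∈ S, P s t ^ 2 - c ^ 2 ≤ #S * (2 * (τ - q) ^ 2) := by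
    have h1 := sum_le_sum hsq
    rw [sum_const, nsmul_eq_mul] at h1
    have h2 : ∑ s ∈ S, ∑ t ∈ S, (q - P s t) ^ 2 =
        #S * (#S * q ^ 2 - 2 * q * c) + ∑ s ∈ S, ∑ t ∈ S, P s t ^ 2 := by
      have e : ∀ s ∈ S, ∑ t ∈ S, (q - P s t) ^ 2 =
          (#S * q ^ 2 - 2 * q * c) + ∑ t ∈ S, P s t ^ 2 := by
        intro s hs
        simp only [sub_sq, sum_add_distrib, sum_sub_distrib, ← mul_sum, hc s hs, sum_const,
          nsmul_eq_mul]
      rw [sum_congr rfl e, sum_add_distrib, sum_const, nsmul_eq_mul]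
    nlinarith [sq_nonneg (c - #S * q)]
  have hτq : 0 < (τ - q) ^ 2 := by have := sub_pos.mpr hqτ; positivity
  have hfin : ((#S : ℝ) - 1) ^ 2 ≤ Fintype.card Ω * τ * (2 * #S) := by
    refine le_of_mul_le_mul_right ?_ hτq
    calc ((#S : ℝ) - 1) ^ 2 * (τ - q) ^ 2 = ((#S - 1) * (τ - q)) ^ 2 := by ring
      _ ≤ (#S * τ - c) ^ 2 := by
        refine pow_le_pow_left₀ (mul_nonneg (by linarith) (by linarith)) ?_ 2
        linarith
      _ ≤ _ := h
      _ ≤ Fintype.card Ω * τ * (#S * (2 * (τ - q) ^ 2)) :=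
        mul_le_mul_of_nonneg_left hsum (by positivity)
      _ = _ := by ring
  refine le_of_mul_le_mul_left (a := (#S : ℝ)) ?_ (by linarith)
  nlinarith

theorem false_of_constant_rectangles (hP : IsConstDiagProj P τ) [Nontrivial Ω] (hτ : τ ≤ 1 / 2)
    (hoff : ∀ a b, a ≠ b → P a b < τ) {R : ℝ} (hR0 : 0 < R)
    (hR1 : 25 * Fintype.card Ω ≤ R ^ 2)
    (hR2 : 512 * (Fintype.card Ω : ℝ) ^ 2 ≤ 1000 * (R ^ 2 * (R - 2)))
    (hrect : ∀ a b, a ≠ b → ∃ S T : Finset Ω, Disjoint S T ∧ R ≤ #S ∧ R ≤ #T ∧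
      (∀ s ∈ S, ∀ t ∈ T, P s t = P a b) ∧ (∃ c, ∀ s ∈ S, ∑ t ∈ S, P s t = c) ∧
      ∃ c, ∀ s ∈ T, ∑ t ∈ T, P s t = c) : False := by
  set N : ℝ := (Fintype.card Ω : ℝ) with hN
  have hN0 : 0 < N := by rw [hN]; exact_mod_cast Fintype.card_pos
  have hne : ∀ S : Finset Ω, R ≤ #S → S.Nonempty := fun S hS => by
    rw [← card_pos]
    exact_mod_cast hR0.trans_le hS
  have hτ0 : 0 ≤ τ := by
    obtain ⟨a⟩ : Nonempty Ω := inferInstance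
    rw [← hP.diag a, ← hP.idem]
    exact sum_nonneg fun x _ => mul_self_nonneg _
  have hpR : ∀ a b, a ≠ b → 4 * P a b ^ 2 * R ^ 2 ≤ 1 := by
    intro a b hab
    obtain ⟨S, T, hd, hS, hT, hp, -⟩ := hrect a b hab
    refine le_trans ?_ (hP.four_mul_sq_mul_le hd hp (hne S hS))
    rw [sq R]
    gcongr
  have hτR : 4 * R ^ 2 * (τ - τ ^ 2) ≤ N := by
    obtain ⟨a⟩ : Nonempty Ω := inferInstance
    have h1 := hP.idem a a
    rw [← add_sum_erase _ _ (mem_univ a), hP.diag] at h1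
    have h2 : ∑ x ∈ univ.erase a, 4 * R ^ 2 * (P x a * P x a) ≤ ∑ x ∈ univ.erase a, 1 :=
      sum_le_sum fun x hx => by
        have := hpR x a (ne_of_mem_erase hx)
        nlinarith
    have h3 : ∑ x ∈ univ.erase a, (1 : ℝ) ≤ N := by
      rw [sum_const, nsmul_eq_mul, mul_one, hN]
      exact_mod_cast card_le_univ _
    rw [← mul_sum] at h2
    have h4 : τ - τ ^ 2 = ∑ x ∈ univ.erase a, P x a * P x a := by linarith
    rw [h4]
    linarith
  have hτ1 : τ ≤ 1 / 50 := by
    have : R ^ 2 * (2 * τ) ≤ R ^ 2 * (1 / 25) := by nlinarith [mul_nonneg (sq_nonneg R) hτ0]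
    have := le_of_mul_le_mul_left this (by positivity)
    linarith
  have hτ2 : 4 * 49 * R ^ 2 * τ ≤ 50 * N := by nlinarith [mul_nonneg (sq_nonneg R) hτ0]
  obtain ⟨⟨a, b⟩, hab, hmax⟩ := exists_max_image (univ.filter fun x : Ω × Ω => x.1 ≠ x.2)
    (fun x => P x.1 x.2) (by
      obtain ⟨a, b, hab⟩ := exists_pair_ne Ω
      exact ⟨(a, b), by simpa using hab⟩)
  simp only [mem_filter, mem_univ, true_and, Prod.forall] at hab hmax
  obtain ⟨S, T, hd, hS, hT, hp, ⟨c, hc⟩, c', hc'⟩ := hrect a b hab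
  set q := P a b
  have hS0 : (0 : ℝ) < #S := by linarith
  have hT0 : (0 : ℝ) < #T := by linarith
  have key : 2 * (#S * #T * q) ≤ #T * c + #S * c' := by
    have h1 : 0 ≤ ∑ x, (#T * ∑ s ∈ S, P x s - #S * ∑ t ∈ T, P x t) ^ 2 :=
      sum_nonneg fun x _ => sq_nonneg _
    have e : ∀ x, (#T * ∑ s ∈ S, P x s - #S * ∑ t ∈ T, P x t) ^ 2 =
        #T ^ 2 * ((∑ s ∈ S, P x s) * ∑ s ∈ S, P x s) +
        #S ^ 2 * ((∑ t ∈ T, P x t) * ∑ t ∈ T, P x t) -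
        2 * #S * #T * ((∑ s ∈ S, P x s) * ∑ t ∈ T, P x t) := fun x => by ring
    simp only [e, sum_add_distrib, sum_sub_distrib, ← mul_sum, hP.sum_sum_mul_sum] at h1
    rw [sum_congr rfl hc, sum_congr rfl hc',
      sum_congr rfl fun s hs => sum_congr rfl fun t ht => hp s hs t ht] at h1
    simp only [sum_const, nsmul_eq_mul] at h1
    refine le_of_mul_le_mul_left (a := (#S : ℝ) * #T) ?_ (by positivity)
    linarith
  have hmain : R - 2 ≤ 2 * N * τ := by
    by_cases h : #S * q ≤ c
    · have := hP.card_sub_two_le (hne S hS) hc hmax (hoff a b hab) h hτ0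
      linarith
    · have h' : #T * q ≤ c' := by
        refine le_of_mul_le_mul_left (a := (#S : ℝ)) ?_ hS0
        nlinarith
      have := hP.card_sub_two_le (hne T hT) hc' hmax (hoff a b hab) h' hτ0
      linarith
  have h1 : R ^ 2 * (R - 2) ≤ R ^ 2 * (2 * N * τ) := by gcongr
  nlinarith

end IsConstDiagProj

end Projection

theorem Matrix.IsSymm.exists_projection {Ω : Type*} [Fintype Ω] [DecidableEq Ω]
    {A : Matrix Ω Ω ℝ} (hA : A.IsSymm) :
    ∃ (s : Finset ℝ) (P : ℝ → Matrix Ω Ω ℝ), A = ∑ l ∈ s, l • P l ∧ (∀ l, (P l).IsSymm) ∧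
      (∀ l, P l * P l = P l) ∧ ∀ B, Commute A B → ∀ l, Commute (P l) B := by
  have hA' : IsSelfAdjoint A := by
    rw [isSelfAdjoint_iff, Matrix.star_eq_conjTranspose,
      Matrix.conjTranspose_eq_transpose_of_trivial]
    exact hA
  have hfin : (spectrum ℝ A).Finite := Matrix.finite_real_spectrum
  have hcont : ∀ f : ℝ → ℝ, ContinuousOn f (spectrum ℝ A) := fun f => hfin.continuousOn f
  refine ⟨hfin.toFinset, fun l => cfc (fun x : ℝ => if x = l then 1 else 0) A, ?_, ?_, ?_, ?_⟩
  · simp_rw [← cfc_smul _ _ A (hcont _)]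
    rw [← cfc_sum _ _ _ (fun i _ => hcont _)]
    conv_lhs => rw [← cfc_id ℝ A]
    refine cfc_congr fun x hx => ?_
    simp [hfin.mem_toFinset, hx]
  · intro l
    have := IsSelfAdjoint.cfc (f := fun x : ℝ => if x = l then 1 else 0) (a := A)
    rwa [isSelfAdjoint_iff, Matrix.star_eq_conjTranspose,
      Matrix.conjTranspose_eq_transpose_of_trivial] at this
  · intro l
    rw [← cfc_mul _ _ A (hcont _) (hcont _)]
    refine cfc_congr fun x hx => ?_
    simp
  · intro B hB l
    exact hB.cfc_real _

/-- Primitivity of a permutation group, phrased with invariant equivalence relations. -/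
def IsSetoidPrimitive {Ω : Type*} (L : Subgroup (Perm Ω)) : Prop :=
  ∀ r : Setoid Ω, (∀ t ∈ L, ∀ a b, r a b → r (t a) (t b)) → r = ⊥ ∨ r = ⊤

section TwoHomogeneous

variable {Ω : Type*} [Fintype Ω] [DecidableEq Ω] {L : Subgroup (Perm Ω)}

theorem commute_permMatrix_iff {A : Matrix Ω Ω ℝ} {t : Perm Ω} :
    Commute A (t.permMatrix ℝ) ↔ ∀ a b, A (t a) (t b) = A a b := by
  rw [Commute, SemiconjBy, ← Matrix.ext_iff, Perm.permMatrix, PEquiv.toMatrix_toPEquiv_mul,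
    PEquiv.mul_toMatrix_toPEquiv]
  simp only [Matrix.submatrix_apply, id]
  refine forall_congr' fun a => ⟨fun h b => ?_, fun h b => ?_⟩
  · rw [← h (t b)]; simp
  · rw [← h]; simp

theorem exists_isConstDiagProj [Nonempty Ω] (ht : ∀ a b, ∃ t ∈ L, t a = b)
    (h : ¬ IsTwoHomogeneous L) : ∃ (P : Ω → Ω → ℝ) (τ : ℝ), IsConstDiagProj P τ ∧ τ ≤ 1 / 2 ∧
      (∀ t ∈ L, ∀ a b, P (t a) (t b) = P a b) ∧
      ∃ a b c d, a ≠ b ∧ c ≠ d ∧ P a b ≠ P c d := by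
  classical
  simp only [IsTwoHomogeneous, not_forall] at h
  obtain ⟨a, b, c, d, hab, hcd, hne⟩ := h
  let A : Matrix Ω Ω ℝ := fun x y =>
    if ∃ t ∈ L, (t a = x ∧ t b = y) ∨ (t a = y ∧ t b = x) then 1 else 0
  have hA : A.IsSymm := by
    ext x y
    change A y x = A x y
    simp only [A]
    congr 1
    simp only [or_comm]
  have hAL : ∀ u ∈ L, ∀ x y, A (u x) (u y) = A x y := by
    intro u hu x y
    simp only [A]
    congr 1
    refine propext ⟨fun ⟨t, htL, h⟩ => ⟨u⁻¹ * t, L.mul_mem (L.inv_mem hu) htL, ?_⟩,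
      fun ⟨t, htL, h⟩ => ⟨u * t, L.mul_mem hu htL, ?_⟩⟩
    · rcases h with ⟨h1, h2⟩ | ⟨h1, h2⟩
      · exact Or.inl (by simp [h1, h2])
      · exact Or.inr (by simp [h1, h2])
    · rcases h with ⟨h1, h2⟩ | ⟨h1, h2⟩
      · exact Or.inl (by simp [h1, h2])
      · exact Or.inr (by simp [h1, h2])
  have hA1 : A a b = 1 := if_pos ⟨1, L.one_mem, by simp⟩
  have hA0 : A c d = 0 := if_neg hne
  obtain ⟨s, P, hAP, hPs, hPi, hPc⟩ := hA.exists_projection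
  obtain ⟨l, hl⟩ : ∃ l, P l a b ≠ P l c d := by
    by_contra! hall
    have : A a b = A c d := by
      rw [hAP]
      simp only [Matrix.sum_apply, Matrix.smul_apply, hall]
    rw [hA1, hA0] at this
    exact one_ne_zero this
  have hPL : ∀ t ∈ L, ∀ x y, P l (t x) (t y) = P l x y := fun t htL =>
    commute_permMatrix_iff.mp (hPc _ (commute_permMatrix_iff.mpr (hAL t htL)) l)
  obtain ⟨o⟩ : Nonempty Ω := inferInstance
  have hdiag : ∀ x, P l x x = P l o o := by
    intro x
    obtain ⟨t, htL, rfl⟩ := ht o x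
    exact hPL t htL o o
  have hsymm : ∀ x y, P l x y = P l y x := fun x y => ((hPs l).apply x y).symm
  have hidem : ∀ x y, ∑ z, P l z x * P l z y = P l x y := by
    intro x y
    have := congrFun (congrFun (hPi l) x) y
    rw [Matrix.mul_apply] at this
    rw [← this]
    exact sum_congr rfl fun z _ => by rw [hsymm z x]
  by_cases hτ : P l o o ≤ 1 / 2
  · exact ⟨P l, P l o o, ⟨hsymm, hidem, hdiag⟩, hτ, hPL, a, b, c, d, hab, hcd, hl⟩
  · refine ⟨fun x y => (if x = y then 1 else 0) - P l x y, 1 - P l o o, ⟨?_, ?_, ?_⟩,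
      by linarith, ?_, a, b, c, d, hab, hcd, ?_⟩
    · intro x y
      simp only [hsymm x y, eq_comm]
    · intro x y
      simp only [sub_mul, mul_sub, sum_sub_distrib, hidem, ite_mul, mul_ite, one_mul, zero_mul,
        mul_one, mul_zero, sum_ite_eq', mem_univ, if_true]
      rw [hsymm y x]
      simp only [eq_comm]
      ring
    · intro x
      simp [hdiag]
    · intro t htL x y
      simp [hPL t htL]
    · simpa [hab, hcd] using hl

theorem IsConstDiagProj.lt_of_isSetoidPrimitive {Ω : Type*} [Fintype Ω] {L : Subgroup (Perm Ω)}
    {P : Ω → Ω → ℝ} {τ : ℝ}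
    (hP : IsConstDiagProj P τ) (hL : IsSetoidPrimitive L)
    (hPL : ∀ t ∈ L, ∀ a b, P (t a) (t b) = P a b)
    (hne : ∃ a b c d, a ≠ b ∧ c ≠ d ∧ P a b ≠ P c d) {a b : Ω} (hab : a ≠ b) : P a b < τ := by
  by_contra! hle
  have hrow : ∀ x, P x a = P x b := by
    have h0 : ∑ x, (P x a - P x b) ^ 2 ≤ 0 := by
      have e : ∀ x, (P x a - P x b) ^ 2 = P x a * P x a + P x b * P x b - 2 * (P x a * P x b) :=
        fun x => by ring
      simp only [e, sum_add_distrib, sum_sub_distrib, ← mul_sum, hP.idem, hP.diag]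
      linarith
    intro x
    have := (sum_eq_zero_iff_of_nonneg fun x _ => sq_nonneg (P x a - P x b)).mp
      (le_antisymm h0 (sum_nonneg fun x _ => sq_nonneg _)) x (mem_univ x)
    exact sub_eq_zero.mp (by simpa using this)
  let r : Setoid Ω := ⟨fun a b => ∀ x, P x a = P x b,
    ⟨fun _ _ => rfl, fun h x => (h x).symm, fun h h' x => (h x).trans (h' x)⟩⟩
  have hr : r a b := hrow
  rcases hL r fun t ht c d hcd x => by
    have hx : x = t (t⁻¹ x) := by simp
    rw [hx, hPL t ht, hPL t ht, hcd] with h | h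
  · rw [h] at hr
    exact hab hr
  · have hall : ∀ c d, P c d = τ := fun c d => by
      have : r d c := by rw [h]; trivial
      rw [this c, hP.diag]
    obtain ⟨a, b, c, d, -, -, h⟩ := hne
    exact h (by rw [hall, hall])

/-- A primitive permutation group is 2-homogeneous if it contains enough rectangular orbits. -/
theorem IsSetoidPrimitive.isTwoHomogeneous (hL : IsSetoidPrimitive L)
    (ht : ∀ a b, ∃ t ∈ L, t a = b) {R : ℝ} (hR0 : 0 < R)
    (hR1 : 25 * Fintype.card Ω ≤ R ^ 2)
    (hR2 : 512 * (Fintype.card Ω : ℝ) ^ 2 ≤ 1000 * (R ^ 2 * (R - 2)))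
    {X : Set Ω} (hX : X.Nonempty) (hX' : X ≠ Set.univ)
    (hrect : ∀ a ∈ X, ∀ b ∉ X, ∃ S T : Finset Ω, Disjoint S T ∧ R ≤ #S ∧ R ≤ #T ∧
      (∀ s ∈ S, ∀ t ∈ T, ∃ u ∈ L, u a = s ∧ u b = t) ∧
      (∀ s ∈ S, ∀ s' ∈ S, ∃ u ∈ L, u s = s' ∧ ∀ x, u x ∈ S ↔ x ∈ S) ∧
      ∀ s ∈ T, ∀ s' ∈ T, ∃ u ∈ L, u s = s' ∧ ∀ x, u x ∈ T ↔ x ∈ T) :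
    IsTwoHomogeneous L := by
  by_contra hcon
  obtain ⟨x0, hx0⟩ := hX
  obtain ⟨y0, hy0⟩ := (Set.ne_univ_iff_exists_notMem X).mp hX'
  have : Nontrivial Ω := ⟨x0, y0, fun h => hy0 (h ▸ hx0)⟩
  obtain ⟨P, τ, hP, hτ, hPL, hne⟩ := exists_isConstDiagProj ht hcon
  have hsep : ∀ a b, a ≠ b → ∃ t ∈ L, ¬ (t a ∈ X ↔ t b ∈ X) := by
    intro a b hab
    by_contra! hall
    let r : Setoid Ω := ⟨fun a b => ∀ t ∈ L, t a ∈ X ↔ t b ∈ X,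
      ⟨fun _ _ _ => Iff.rfl, fun h t ht => (h t ht).symm,
        fun h h' t ht => (h t ht).trans (h' t ht)⟩⟩
    have hr : r a b := hall
    rcases hL r fun u hu c d hcd t ht => by simpa using hcd (t * u) (L.mul_mem ht hu) with h | h
    · rw [h] at hr
      exact hab hr
    · have : r x0 y0 := by rw [h]; trivial
      exact hy0 ((this 1 L.one_mem).mp hx0)
  have hrow : ∀ S : Finset Ω, R ≤ #S →
      (∀ s ∈ S, ∀ s' ∈ S, ∃ u ∈ L, u s = s' ∧ ∀ x, u x ∈ S ↔ x ∈ S) →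
      ∃ c, ∀ s ∈ S, ∑ t ∈ S, P s t = c := by
    intro S hS hu
    obtain ⟨s, hs⟩ : S.Nonempty := by
      rw [← card_pos]
      exact_mod_cast hR0.trans_le hS
    refine ⟨∑ t ∈ S, P s t, fun s' hs' => ?_⟩
    obtain ⟨u, huL, rfl, huS⟩ := hu s hs s' hs'
    exact (sum_equiv u (fun x => (huS x).symm) fun x _ => (hPL u huL s x).symm).symm
  refine hP.false_of_constant_rectangles hτ
    (fun a b hab => hP.lt_of_isSetoidPrimitive hL hPL hne hab) hR0 hR1 hR2 fun a b hab => ?_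
  obtain ⟨t, htL, hsp⟩ := hsep a b hab
  by_cases hta : t a ∈ X
  · have htb : t b ∉ X := fun h => hsp (iff_of_true hta h)
    obtain ⟨S, T, hd, hS, hT, hST, hS', hT'⟩ := hrect _ hta _ htb
    refine ⟨S, T, hd, hS, hT, fun s hs t' ht' => ?_, hrow S hS hS', hrow T hT hT'⟩
    obtain ⟨u, hu, rfl, rfl⟩ := hST s hs t' ht'
    rw [hPL u hu, hPL t htL]
  · have htb : t b ∈ X := by
      by_contra h
      exact hsp (iff_of_false hta h)
    obtain ⟨S, T, hd, hS, hT, hST, hS', hT'⟩ := hrect _ htb _ hta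
    refine ⟨S, T, hd, hS, hT, fun s hs t' ht' => ?_, hrow S hS hS', hrow T hT hT'⟩
    obtain ⟨u, hu, rfl, rfl⟩ := hST s hs t' ht'
    rw [hPL u hu, hPL t htL, hP.symm]

end TwoHomogeneous

end

section

open Equiv Equiv.Perm Finset

open Function in
theorem Equiv.Perm.card_sameCycle_eq_minimalPeriod {Ω : Type*} [Fintype Ω] [DecidableEq Ω]
    (g : Perm Ω) (x : Ω) : #{w | g.SameCycle x w} = minimalPeriod g x := by
  have : ({w | g.SameCycle x w} : Finset Ω) =
      (range (minimalPeriod g x)).image fun k => g^[k] x := by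
    ext w
    simp only [mem_filter, mem_univ, true_and, mem_image, mem_range]
    constructor
    · rintro h
      obtain ⟨k, -, -, hk⟩ := h.exists_pow_eq''
      refine ⟨k % minimalPeriod g x, Nat.mod_lt _ ?_, ?_⟩
      · exact minimalPeriod_pos_of_mem_periodicPts
          (Finite.injective_iff_bijective.mp g.injective |>.injective.mem_periodicPts x)
      · rw [iterate_mod_minimalPeriod_eq, ← hk, iterate_eq_pow]
    · rintro ⟨k, -, rfl⟩
      exact ⟨k, by rw [iterate_eq_pow, zpow_natCast]⟩
  rw [this, card_image_of_injOn, card_range]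
  intro i hi j hj h
  exact iterate_injOn_Iio_minimalPeriod (by simpa using hi) (by simpa using hj) h

section Blocks

open Function

variable {Ω : Type*} [Fintype Ω] [DecidableEq Ω] {g : Perm Ω} {r : Setoid Ω}

/-- The length of the cycle containing the block of `x`, for the action on the blocks. -/
noncomputable def blockPeriod (hg : ∀ a b, r a b → r (g a) (g b)) (x : Ω) : ℕ :=
  minimalPeriod (Quotient.map g hg) (Quotient.mk r x)

theorem rel_iterate_iff {Ω : Type*} {g : Perm Ω} {r : Setoid Ω}
    (hg : ∀ a b, r a b → r (g a) (g b)) (x : Ω) (k : ℕ) :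
    r x (g^[k] x) ↔ blockPeriod hg x ∣ k := by
  have h : ∀ k y, (Quotient.map g hg)^[k] (Quotient.mk r y) = Quotient.mk r (g^[k] y) := by
    intro k
    induction k with
    | zero => simp
    | succ k ih => intro y; rw [iterate_succ_apply, iterate_succ_apply, ← ih]; rfl
  rw [blockPeriod, ← isPeriodicPt_iff_minimalPeriod_dvd, IsPeriodicPt, IsFixedPt, h,
    Quotient.eq, comm_of r]

theorem blockPeriod_congr {Ω : Type*} {g : Perm Ω} {r : Setoid Ω}
    (hg : ∀ a b, r a b → r (g a) (g b)) {x y : Ω} (h : r x y) :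
    blockPeriod hg x = blockPeriod hg y := by
  rw [blockPeriod, blockPeriod, Quotient.sound h]

theorem rel_zpow {Ω : Type*} [Fintype Ω] {g : Perm Ω} {r : Setoid Ω}
    (hg : ∀ a b, r a b → r (g a) (g b)) {x y : Ω} (h : r x y) (k : ℤ) :
    r ((g ^ k) x) ((g ^ k) y) := by
  have hpow : ∀ k : ℕ, r ((g ^ k) x) ((g ^ k) y) := by
    intro k
    induction k with
    | zero => simpa
    | succ k ih => rw [pow_succ', mul_apply, mul_apply]; exact hg _ _ ih
  obtain ⟨k', hk'⟩ : ∃ k' : ℕ, g ^ k = g ^ k' := by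
    have : g ^ k ∈ Subgroup.zpowers g := ⟨k, rfl⟩
    rw [← mem_powers_iff_mem_zpowers] at this
    obtain ⟨k', hk'⟩ := this
    exact ⟨k', hk'.symm⟩
  rw [hk']
  exact hpow k'

theorem blockPeriod_eq_of_sameCycle {Ω : Type*} [Fintype Ω] {g : Perm Ω} {r : Setoid Ω}
    (hg : ∀ a b, r a b → r (g a) (g b)) {x y : Ω}
    (h : g.SameCycle x y) : blockPeriod hg x = blockPeriod hg y := by
  have key : ∀ x y, g.SameCycle x y → blockPeriod hg y ∣ blockPeriod hg x := by
    rintro x y ⟨k, rfl⟩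
    rw [← rel_iterate_iff, iterate_eq_pow, ← mul_apply, ← zpow_natCast, ← zpow_add, add_comm,
      zpow_add, mul_apply]
    refine rel_zpow hg ?_ k
    rw [zpow_natCast, ← iterate_eq_pow, rel_iterate_iff hg]
  exact Nat.dvd_antisymm (key _ _ h.symm) (key _ _ h)

open Classical in
theorem card_block_inter_cycle (hg : ∀ a b, r a b → r (g a) (g b)) (x : Ω) :
    #{w | r x w ∧ g.SameCycle x w} * blockPeriod hg x = minimalPeriod g x := by
  have hdvd : blockPeriod hg x ∣ minimalPeriod g x := by
    rw [← rel_iterate_iff, iterate_minimalPeriod]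
  have hS : ({w | r x w ∧ g.SameCycle x w} : Finset Ω) =
      ({w | (g ^ blockPeriod hg x).SameCycle x w} : Finset Ω) := by
    ext w
    simp only [mem_filter, mem_univ, true_and]
    constructor
    · rintro ⟨h1, h2⟩
      obtain ⟨k, -, -, rfl⟩ := h2.exists_pow_eq''
      rw [← iterate_eq_pow, rel_iterate_iff hg] at h1
      obtain ⟨j, rfl⟩ := h1
      exact ⟨j, by rw [pow_mul, zpow_natCast]⟩
    · intro h
      obtain ⟨k, -, -, rfl⟩ := h.exists_pow_eq''
      rw [← pow_mul]
      refine ⟨?_, ⟨(blockPeriod hg x * _ : ℕ), by rw [zpow_natCast]⟩⟩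
      rw [← iterate_eq_pow, rel_iterate_iff hg]
      exact dvd_mul_right _ _
  rw [hS, card_sameCycle_eq_minimalPeriod, ← iterate_eq_pow]
  by_cases h0 : blockPeriod hg x = 0
  · rw [h0] at hdvd
    rw [h0, Nat.eq_zero_of_zero_dvd hdvd, mul_zero]
  · rw [minimalPeriod_iterate_eq_div_gcd h0, Nat.gcd_eq_right hdvd, Nat.div_mul_cancel hdvd]

end Blocks

/-- A triple of positive cycle lengths `a, b, c` which, for the bound `R`, forces a transitive
group containing a permutation of that cycle type to contain the alternating group. -/
structure IsGoodTriple (R a b c : ℕ) : Prop where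
  gcd_eq_one : ∀ d, d ∣ a → d ∣ b → d ∣ c → d = 1
  not_dvd₁ : ¬ (b + c) / b.gcd c ∣ a + b + c
  not_dvd₂ : ¬ (a + c) / a.gcd c ∣ a + b + c
  not_dvd₃ : ¬ (a + b) / a.gcd b ∣ a + b + c
  rect : (R * a.gcd b ≤ min a b ∧ R * a.gcd c ≤ min a c) ∨
    (R * a.gcd b ≤ min a b ∧ R * b.gcd c ≤ min b c) ∨
    (R * a.gcd c ≤ min a c ∧ R * b.gcd c ≤ min b c)
  gcd_lt : a.gcd b < R ∧ a.gcd c < R ∧ b.gcd c < R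
  small : 25 * a ≤ 8 * (a + b + c) ∨ 25 * b ≤ 8 * (a + b + c) ∨ 25 * c ≤ 8 * (a + b + c)

theorem IsGoodTriple.swap {R a b c : ℕ} (h : IsGoodTriple R a b c) : IsGoodTriple R b a c := by
  obtain ⟨h1, h2, h3, h4, h5, h6, h7⟩ := h
  rw [Nat.gcd_comm a b, min_comm a b] at *
  rw [add_comm a b] at *
  exact ⟨fun d ha hb => h1 d hb ha, h3, h2, h4, by tauto, by tauto, by tauto⟩

theorem IsGoodTriple.swap' {R a b c : ℕ} (h : IsGoodTriple R a b c) : IsGoodTriple R a c b := by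
  obtain ⟨h1, h2, h3, h4, h5, h6, h7⟩ := h
  rw [Nat.gcd_comm b c, min_comm b c] at *
  rw [add_comm b c] at *
  rw [add_right_comm a b c] at *
  exact ⟨fun d ha hb hc => h1 d ha hc hb, h2, h4, h3, by tauto, by tauto, by tauto⟩

/-- The permutation `g` has exactly three cycles (fixed points included), through `x, y, z`. -/
structure HasThreeCycles {Ω : Type*} (g : Perm Ω) (x y z : Ω) : Prop where
  not_xy : ¬ g.SameCycle x y
  not_xz : ¬ g.SameCycle x z
  not_yz : ¬ g.SameCycle y z
  cover : ∀ w, g.SameCycle x w ∨ g.SameCycle y w ∨ g.SameCycle z w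

theorem HasThreeCycles.swap {Ω : Type*} {g : Perm Ω} {x y z : Ω} (h : HasThreeCycles g x y z) :
    HasThreeCycles g y x z :=
  ⟨fun h' => h.not_xy h'.symm, h.not_yz, h.not_xz, fun w => by have := h.cover w; tauto⟩

theorem HasThreeCycles.swap' {Ω : Type*} {g : Perm Ω} {x y z : Ω} (h : HasThreeCycles g x y z) :
    HasThreeCycles g x z y :=
  ⟨h.not_xz, h.not_xy, fun h' => h.not_yz h'.symm, fun w => by have := h.cover w; tauto⟩

section Primitive

open Function

variable {Ω : Type*} [Fintype Ω] [DecidableEq Ω] {g : Perm Ω} {r : Setoid Ω} {x y z : Ω}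

open Classical in
theorem HasThreeCycles.card_eq_add (h : HasThreeCycles g x y z) (p : Ω → Prop) :
    #{w | p w} = #{w | p w ∧ g.SameCycle x w} + #{w | p w ∧ g.SameCycle y w} +
      #{w | p w ∧ g.SameCycle z w} := by
  rw [← card_union_of_disjoint, ← card_union_of_disjoint, ← filter_or, ← filter_or]
  · congr 1
    ext w
    have := h.cover w
    simp only [mem_filter, mem_univ, true_and]
    tauto
  · rw [← filter_or, disjoint_filter]
    rintro w - (⟨-, h1⟩ | ⟨-, h1⟩) ⟨-, h2⟩
    · exact h.not_xz (h1.trans h2.symm)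
    · exact h.not_yz (h1.trans h2.symm)
  · rw [disjoint_filter]
    rintro w - ⟨-, h1⟩ ⟨-, h2⟩
    exact h.not_xy (h1.trans h2.symm)

theorem HasThreeCycles.card_eq (h : HasThreeCycles g x y z) :
    Fintype.card Ω = minimalPeriod g x + minimalPeriod g y + minimalPeriod g z := by
  classical
  simpa [card_sameCycle_eq_minimalPeriod] using h.card_eq_add fun _ => True

open Classical in
theorem card_block_inter_cycle_of_rel (hg : ∀ a b, r a b → r (g a) (g b)) {w : Ω}
    (hyw : g.SameCycle y w) (hxw : r x w) :
    blockPeriod hg x = blockPeriod hg y ∧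
      #{w | r x w ∧ g.SameCycle y w} * blockPeriod hg y = minimalPeriod g y := by
  have hwy : blockPeriod hg y = blockPeriod hg w := blockPeriod_eq_of_sameCycle hg hyw
  refine ⟨(blockPeriod_congr hg hxw).trans hwy.symm, ?_⟩
  have h1 : ∀ u, r x u ↔ r w u := fun u => ⟨fun h => r.trans (r.symm hxw) h, fun h => r.trans hxw h⟩
  have h2 : ∀ u, g.SameCycle y u ↔ g.SameCycle w u :=
    fun u => ⟨fun h => hyw.symm.trans h, fun h => hyw.trans h⟩
  simp only [h1, h2]
  rw [hwy, card_block_inter_cycle hg, ← card_sameCycle_eq_minimalPeriod,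
    ← card_sameCycle_eq_minimalPeriod]
  simp only [h2]

theorem HasThreeCycles.eq_top_of_linked (h : HasThreeCycles g x y z)
    (hgcd : ∀ d, d ∣ minimalPeriod g x → d ∣ minimalPeriod g y → d ∣ minimalPeriod g z → d = 1)
    (hg : ∀ a b, r a b → r (g a) (g b)) (hy : ∃ w, g.SameCycle y w ∧ r x w)
    (hz : ∃ w, g.SameCycle z w ∧ r x w) : r = ⊤ := by
  classical
  obtain ⟨u, hyu, hxu⟩ := hy
  obtain ⟨v, hzv, hxv⟩ := hz
  obtain ⟨ey, hy⟩ := card_block_inter_cycle_of_rel hg hyu hxu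
  obtain ⟨ez, hz⟩ := card_block_inter_cycle_of_rel hg hzv hxv
  have e1 : blockPeriod hg x = 1 := hgcd _ (Dvd.intro_left _ (card_block_inter_cycle hg x))
    (ey ▸ Dvd.intro_left _ hy) (ez ▸ Dvd.intro_left _ hz)
  have key : ∀ a b, r x a → g.SameCycle a b → r x b := by
    intro a b hxa hab
    obtain ⟨k, -, -, rfl⟩ := hab.exists_pow_eq''
    rw [← iterate_eq_pow]
    refine r.trans hxa ((rel_iterate_iff hg a k).mpr ?_)
    rw [← blockPeriod_congr hg hxa, e1]
    exact one_dvd k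
  have hall : ∀ w, r x w := by
    intro w
    rcases h.cover w with hw | hw | hw
    · exact key x w (r.refl x) hw
    · exact key u w hxu (hyu.symm.trans hw)
    · exact key v w hxv (hzv.symm.trans hw)
  exact eq_top_iff.mpr fun a b _ => r.trans (r.symm (hall a)) (hall b)

open Classical in
theorem HasThreeCycles.div_gcd_dvd_of_linked (h : HasThreeCycles g x y z)
    (hg : ∀ a b, r a b → r (g a) (g b)) {d : ℕ} (hd : ∀ u, #{w | r u w} = d)
    (hxy : ¬ ∃ w, g.SameCycle y w ∧ r x w) (hxz : ¬ ∃ w, g.SameCycle z w ∧ r x w)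
    (hyx : ¬ ∃ w, g.SameCycle x w ∧ r y w) (hyz : ∃ w, g.SameCycle z w ∧ r y w) :
    (minimalPeriod g y + minimalPeriod g z) / (minimalPeriod g y).gcd (minimalPeriod g z) ∣
      minimalPeriod g x + minimalPeriod g y + minimalPeriod g z := by
  push Not at hxy hxz hyx
  obtain ⟨u, hzu, hyu⟩ := hyz
  obtain ⟨ez, hz⟩ := card_block_inter_cycle_of_rel hg hzu hyu
  have hx := card_block_inter_cycle hg x
  have hy := card_block_inter_cycle hg y
  have hdx := h.card_eq_add (r x)
  have hdy := h.card_eq_add (r y)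
  rw [hd, filter_false_of_mem (s := univ) (p := fun w => r x w ∧ g.SameCycle y w)
    fun w _ h' => hxy w h'.2 h'.1, filter_false_of_mem (s := univ)
    (p := fun w => r x w ∧ g.SameCycle z w) fun w _ h' => hxz w h'.2 h'.1, card_empty, add_zero,
    add_zero] at hdx
  rw [hd, filter_false_of_mem (s := univ) (p := fun w => r y w ∧ g.SameCycle x w)
    fun w _ h' => hyx w h'.2 h'.1, card_empty, zero_add] at hdy
  rw [← hdx] at hx
  rw [← ez] at hz
  have hsum : d * blockPeriod hg y = minimalPeriod g y + minimalPeriod g z := by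
    rw [hdy, add_mul, hy, hz]
  have he : blockPeriod hg y ∣ (minimalPeriod g y).gcd (minimalPeriod g z) :=
    Nat.dvd_gcd (Dvd.intro_left _ hy) (Dvd.intro_left _ hz)
  have hdn : d ∣ minimalPeriod g x + minimalPeriod g y + minimalPeriod g z := by
    rw [add_assoc, ← hsum, ← hx, ← mul_add]
    exact dvd_mul_right _ _
  refine dvd_trans ?_ hdn
  obtain ⟨k, hk⟩ := he
  have hpos : 0 < (minimalPeriod g y).gcd (minimalPeriod g z) := by
    refine Nat.gcd_pos_of_pos_left _ ?_
    rw [← card_sameCycle_eq_minimalPeriod, card_pos]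
    exact ⟨y, by simp [SameCycle.refl]⟩
  have hdvd : (minimalPeriod g y).gcd (minimalPeriod g z) ∣ d * blockPeriod hg y := by
    rw [hsum]
    exact dvd_add (Nat.gcd_dvd_left _ _) (Nat.gcd_dvd_right _ _)
  rw [← hsum]
  rw [hk] at hdvd hpos ⊢
  have he0 : 0 < blockPeriod hg y := Nat.pos_of_mul_pos_right hpos
  rw [mul_comm d] at hdvd ⊢
  rw [Nat.mul_div_mul_left _ _ he0]
  exact Nat.div_dvd_of_dvd (Nat.dvd_of_mul_dvd_mul_left he0 hdvd)

/-- A transitive group containing a permutation with three cycles of suitable lengths is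
primitive. -/
theorem HasThreeCycles.isSetoidPrimitive (h : HasThreeCycles g x y z) {R : ℕ}
    (hR : IsGoodTriple R (minimalPeriod g x) (minimalPeriod g y) (minimalPeriod g z))
    {L : Subgroup (Perm Ω)} (hgL : g ∈ L) (ht : ∀ a b, ∃ t ∈ L, t a = b) :
    IsSetoidPrimitive L := by
  classical
  intro r hr
  have hg := hr g hgL
  have hd : ∀ u, #{w | r u w} = #{w | r x w} := by
    intro u
    obtain ⟨t, htL, rfl⟩ := ht x u
    symm
    refine card_bijective t t.bijective fun w => ?_
    simp only [mem_filter, mem_univ, true_and]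
    exact ⟨hr t htL x w, fun h' => by simpa using hr _ (L.inv_mem htL) _ _ h'⟩
  have hsymm : ∀ a b, (∃ w, g.SameCycle b w ∧ r a w) → ∃ w, g.SameCycle a w ∧ r b w := by
    rintro a b ⟨w, ⟨k, rfl⟩, hw⟩
    refine ⟨(g ^ (-k)) a, ⟨-k, rfl⟩, ?_⟩
    have := rel_zpow hg hw (-k)
    rw [← mul_apply, ← zpow_add, neg_add_cancel, zpow_zero, one_apply] at this
    exact r.symm this
  have h1 := hR.gcd_eq_one
  by_cases hxy : ∃ w, g.SameCycle y w ∧ r x w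
  · by_cases hxz : ∃ w, g.SameCycle z w ∧ r x w
    · exact Or.inr (h.eq_top_of_linked h1 hg hxy hxz)
    · by_cases hyz : ∃ w, g.SameCycle z w ∧ r y w
      · exact Or.inr (h.swap.eq_top_of_linked hR.swap.gcd_eq_one hg (hsymm _ _ hxy) hyz)
      · exact absurd (h.swap'.swap.div_gcd_dvd_of_linked hg hd (fun h' => hxz (hsymm _ _ h'))
          (fun h' => hyz (hsymm _ _ h')) hxz hxy) hR.swap'.swap.not_dvd₁
  · by_cases hxz : ∃ w, g.SameCycle z w ∧ r x w
    · by_cases hyz : ∃ w, g.SameCycle z w ∧ r y w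
      · exact Or.inr (h.swap'.swap.eq_top_of_linked hR.swap'.swap.gcd_eq_one hg (hsymm _ _ hxz)
          (hsymm _ _ hyz))
      · exact absurd (h.swap.div_gcd_dvd_of_linked hg hd (fun h' => hxy (hsymm _ _ h'))
          hyz hxy hxz) hR.swap.not_dvd₁
    · by_cases hyz : ∃ w, g.SameCycle z w ∧ r y w
      · exact absurd (h.div_gcd_dvd_of_linked hg hd hxy hxz (fun h' => hxy (hsymm _ _ h')) hyz)
          hR.not_dvd₁
      · left
        have key : ∀ a b c, HasThreeCycles g a b c → (¬ ∃ w, g.SameCycle b w ∧ r a w) →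
            (¬ ∃ w, g.SameCycle c w ∧ r a w) → #{w | r x w} ∣ minimalPeriod g a := by
          intro a b c habc hab hac
          push Not at hab hac
          have hda := habc.card_eq_add (r a)
          rw [hd, filter_false_of_mem (s := univ) (p := fun w => r a w ∧ g.SameCycle b w)
            fun w _ h' => hab w h'.2 h'.1, filter_false_of_mem (s := univ)
            (p := fun w => r a w ∧ g.SameCycle c w) fun w _ h' => hac w h'.2 h'.1, card_empty,
            add_zero, add_zero] at hda
          rw [hda]
          exact Dvd.intro _ (card_block_inter_cycle hg a)
        have hd1 := h1 _ (key x y z h hxy hxz)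
          (key y x z h.swap (fun h' => hxy (hsymm _ _ h')) hyz)
          (key z x y h.swap'.swap (fun h' => hxz (hsymm _ _ h')) fun h' => hyz (hsymm _ _ h'))
        refine eq_bot_iff.mpr fun a b hab => ?_
        have hda := hd a
        rw [hd1, card_eq_one] at hda
        obtain ⟨c, hc⟩ := hda
        have ha : a ∈ ({c} : Finset Ω) := hc ▸ by simp
        have hb : b ∈ ({c} : Finset Ω) := hc ▸ by simpa using hab
        rw [mem_singleton] at ha hb
        exact ha.trans hb.symm

end Primitive

section Key

open Function

variable {Ω : Type*} [Fintype Ω] [DecidableEq Ω] {g : Perm Ω} {x y z : Ω} {L : Subgroup (Perm Ω)}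

theorem Equiv.Perm.SameCycle.minimalPeriod_eq {a b : Ω} (h : g.SameCycle a b) :
    minimalPeriod g a = minimalPeriod g b := by
  rw [← card_sameCycle_eq_minimalPeriod, ← card_sameCycle_eq_minimalPeriod]
  congr 1
  ext w
  simp only [mem_filter, mem_univ, true_and]
  exact ⟨fun h' => h.symm.trans h', fun h' => h.trans h'⟩

theorem Equiv.Perm.minimalPeriod_pos (g : Perm Ω) (x : Ω) : 0 < minimalPeriod g x := by
  rw [← card_sameCycle_eq_minimalPeriod, card_pos]
  exact ⟨x, by simp [SameCycle.refl]⟩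

theorem exists_rectangle_of_not_sameCycle (hg : g ∈ L) {a b : Ω} (hab : ¬ g.SameCycle a b) {R : ℕ}
    (hR : R * (minimalPeriod g a).gcd (minimalPeriod g b) ≤
      min (minimalPeriod g a) (minimalPeriod g b)) :
    ∃ S T : Finset Ω, Disjoint S T ∧ R ≤ #S ∧ R ≤ #T ∧
      (∀ s ∈ S, ∀ t ∈ T, ∃ u ∈ L, u a = s ∧ u b = t) ∧
      (∀ s ∈ S, ∀ s' ∈ S, ∃ u ∈ L, u s = s' ∧ ∀ x, u x ∈ S ↔ x ∈ S) ∧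
      ∀ s ∈ T, ∀ s' ∈ T, ∃ u ∈ L, u s = s' ∧ ∀ x, u x ∈ T ↔ x ∈ T := by
  set d := (minimalPeriod g a).gcd (minimalPeriod g b) with hd
  have hd0 : 0 < d := Nat.gcd_pos_of_pos_left _ (minimalPeriod_pos g a)
  have hcyc : ∀ c, d ∣ minimalPeriod g c → R * d ≤ minimalPeriod g c →
      R ≤ #{w | (g ^ d).SameCycle c w} := by
    intro c hc hRc
    rw [card_sameCycle_eq_minimalPeriod, ← iterate_eq_pow,
      minimalPeriod_iterate_eq_div_gcd hd0.ne', Nat.gcd_eq_right hc]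
    exact (Nat.le_div_iff_mul_le hd0).mpr hRc
  have hshift : ∀ c, ∀ s ∈ ({w | (g ^ d).SameCycle c w} : Finset Ω),
      ∀ s' ∈ ({w | (g ^ d).SameCycle c w} : Finset Ω), ∃ u ∈ L, u s = s' ∧
        ∀ x, u x ∈ ({w | (g ^ d).SameCycle c w} : Finset Ω) ↔
          x ∈ ({w | (g ^ d).SameCycle c w} : Finset Ω) := by
    intro c s hs s' hs'
    simp only [mem_filter, mem_univ, true_and] at hs hs' ⊢
    obtain ⟨k, rfl⟩ := hs.symm.trans hs'
    exact ⟨(g ^ d) ^ k, L.zpow_mem (L.pow_mem hg d) k, rfl, fun x => sameCycle_zpow_right⟩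
  refine ⟨({w | (g ^ d).SameCycle a w} : Finset Ω), ({w | (g ^ d).SameCycle b w} : Finset Ω), ?_,
    hcyc a (Nat.gcd_dvd_left _ _) (hR.trans (min_le_left _ _)),
    hcyc b (Nat.gcd_dvd_right _ _) (hR.trans (min_le_right _ _)), ?_, hshift a, hshift b⟩
  · rw [disjoint_filter]
    rintro w - h1 h2
    exact hab (h1.trans h2.symm).of_pow
  · intro s hs t ht
    simp only [mem_filter, mem_univ, true_and] at hs ht
    obtain ⟨i, -, -, rfl⟩ := hs.exists_pow_eq''
    obtain ⟨j, -, -, rfl⟩ := ht.exists_pow_eq''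
    have hmod : d * i ≡ d * j [MOD d] := by
      simp [Nat.ModEq]
    obtain ⟨k, hk1, hk2⟩ := Nat.chineseRemainder' hmod
    refine ⟨g ^ k, L.pow_mem hg k, ?_, ?_⟩
    · rw [← pow_mul, ← iterate_eq_pow, ← iterate_eq_pow, ← iterate_mod_minimalPeriod_eq, hk1,
        iterate_mod_minimalPeriod_eq]
    · rw [← pow_mul, ← iterate_eq_pow, ← iterate_eq_pow, ← iterate_mod_minimalPeriod_eq, hk2,
        iterate_mod_minimalPeriod_eq]

theorem HasThreeCycles.isTwoHomogeneous_of_rect (h : HasThreeCycles g x y z)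
    (hL : IsSetoidPrimitive L) (hg : g ∈ L) (ht : ∀ a b, ∃ t ∈ L, t a = b) {R : ℕ} (hR0 : 0 < R)
    (hR1 : 25 * (Fintype.card Ω : ℝ) ≤ (R : ℝ) ^ 2)
    (hR2 : 512 * (Fintype.card Ω : ℝ) ^ 2 ≤ 1000 * ((R : ℝ) ^ 2 * (R - 2)))
    (hxy : R * (minimalPeriod g x).gcd (minimalPeriod g y) ≤
      min (minimalPeriod g x) (minimalPeriod g y))
    (hxz : R * (minimalPeriod g x).gcd (minimalPeriod g z) ≤
      min (minimalPeriod g x) (minimalPeriod g z)) : IsTwoHomogeneous L := by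
  refine hL.isTwoHomogeneous ht (R := R) (by exact_mod_cast hR0) hR1 hR2
    (X := {w | g.SameCycle x w}) ⟨x, SameCycle.refl g x⟩
    (fun h' => h.not_xy (h' ▸ Set.mem_univ y : y ∈ {w | g.SameCycle x w})) ?_
  intro a ha b hb
  simp only [Set.mem_ofPred_eq] at ha hb
  simp only [Nat.cast_le]
  refine exists_rectangle_of_not_sameCycle hg (fun h' => hb (ha.trans h')) ?_
  rw [← ha.minimalPeriod_eq]
  rcases h.cover b with hb' | hb' | hb'
  · exact absurd hb' hb
  · rwa [← hb'.minimalPeriod_eq]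
  · rwa [← hb'.minimalPeriod_eq]

theorem IsGoodTriple.not_dvd_lcm {R a b c : ℕ} (h : IsGoodTriple R a b c) (ha : 0 < a) :
    ¬ a ∣ b.lcm c := by
  intro hdvd
  have h1 : a ∣ a.gcd b * a.gcd c :=
    (Nat.dvd_gcd dvd_rfl (hdvd.trans (Nat.lcm_dvd_mul b c))).trans
      (Nat.gcd_mul_right_dvd_mul_gcd a b c)
  have hb : 0 < a.gcd b := Nat.gcd_pos_of_pos_left _ ha
  have hc : 0 < a.gcd c := Nat.gcd_pos_of_pos_left _ ha
  have h2 := Nat.le_of_dvd (Nat.mul_pos hb hc) h1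
  obtain ⟨h3, h4, -⟩ := h.gcd_lt
  have key : R * a.gcd b ≤ a ∨ R * a.gcd c ≤ a := by
    rcases h.rect with ⟨h', -⟩ | ⟨h', -⟩ | ⟨h', -⟩
    · exact Or.inl (h'.trans (min_le_left _ _))
    · exact Or.inl (h'.trans (min_le_left _ _))
    · exact Or.inr (h'.trans (min_le_left _ _))
  rcases key with h' | h' <;> nlinarith

theorem HasThreeCycles.exists_small_support (h : HasThreeCycles g x y z) {R : ℕ}
    (hR : IsGoodTriple R (minimalPeriod g x) (minimalPeriod g y) (minimalPeriod g z))
    (hg : g ∈ L) (hx : 25 * minimalPeriod g x ≤ 8 * Fintype.card Ω) :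
    ∃ u ∈ L, u ≠ 1 ∧ 25 * #u.support ≤ 8 * Fintype.card Ω := by
  refine ⟨g ^ (minimalPeriod g y).lcm (minimalPeriod g z), L.pow_mem hg _, fun h1 => ?_, ?_⟩
  · refine hR.not_dvd_lcm (minimalPeriod_pos g x) ?_
    rw [← isPeriodicPt_iff_minimalPeriod_dvd, IsPeriodicPt, IsFixedPt, iterate_eq_pow, h1,
      one_apply]
  · have hfix : ∀ c w, g.SameCycle c w →
        minimalPeriod g c ∣ (minimalPeriod g y).lcm (minimalPeriod g z) →
        (g ^ (minimalPeriod g y).lcm (minimalPeriod g z)) w = w := by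
      intro c w hcw hc
      rw [hcw.minimalPeriod_eq, ← isPeriodicPt_iff_minimalPeriod_dvd] at hc
      rw [← iterate_eq_pow]
      exact hc
    refine le_trans (Nat.mul_le_mul_left _ ?_) hx
    rw [← card_sameCycle_eq_minimalPeriod g x]
    refine card_le_card fun w hw => ?_
    rw [Perm.mem_support] at hw
    simp only [mem_filter, mem_univ, true_and]
    rcases h.cover w with hw' | hw' | hw'
    · exact hw'
    · exact absurd (hfix y w hw' (Nat.dvd_lcm_left _ _)) hw
    · exact absurd (hfix z w hw' (Nat.dvd_lcm_right _ _)) hw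

/-- A transitive group containing a permutation whose three cycle lengths form a good triple
contains the alternating group. -/
theorem HasThreeCycles.alternatingGroup_le (h : HasThreeCycles g x y z) {R : ℕ}
    (hR : IsGoodTriple R (minimalPeriod g x) (minimalPeriod g y) (minimalPeriod g z))
    (hg : g ∈ L) (ht : ∀ a b, ∃ t ∈ L, t a = b) (hn : 100000 ≤ Fintype.card Ω)
    (hR1 : 25 * (Fintype.card Ω : ℝ) ≤ (R : ℝ) ^ 2)
    (hR2 : 512 * (Fintype.card Ω : ℝ) ^ 2 ≤ 1000 * ((R : ℝ) ^ 2 * (R - 2))) :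
    alternatingGroup Ω ≤ L := by
  have hprim := h.isSetoidPrimitive hR hg ht
  have hR0 : 0 < R := (Nat.zero_le _).trans_lt hR.gcd_lt.1
  have hhom : IsTwoHomogeneous L := by
    rcases hR.rect with ⟨h1, h2⟩ | ⟨h1, h2⟩ | ⟨h1, h2⟩
    · exact h.isTwoHomogeneous_of_rect hprim hg ht hR0 hR1 hR2 h1 h2
    · exact h.swap.isTwoHomogeneous_of_rect hprim hg ht hR0 hR1 hR2
        (by rwa [Nat.gcd_comm, min_comm]) h2
    · exact h.swap'.swap.isTwoHomogeneous_of_rect hprim hg ht hR0 hR1 hR2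
        (by rwa [Nat.gcd_comm, min_comm]) (by rwa [Nat.gcd_comm, min_comm])
  have hsmall := hR.small
  rw [← h.card_eq] at hsmall
  obtain ⟨u, hu, hu1, hun⟩ : ∃ u ∈ L, u ≠ 1 ∧ 25 * #u.support ≤ 8 * Fintype.card Ω := by
    rcases hsmall with h1 | h1 | h1
    · exact h.exists_small_support hR hg h1
    · exact h.swap.exists_small_support hR.swap hg h1
    · exact h.swap'.swap.exists_small_support hR.swap'.swap hg h1
  exact hhom.alternatingGroup_le ht hn hu hu1 hun

open Classical in
/-- An invariant set is a union of cycles. -/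
theorem HasThreeCycles.card_invariant (h : HasThreeCycles g x y z) {p : Ω → Prop}
    (hp : ∀ w, p w → p (g w)) :
    ∃ i j k : Bool, #{w | p w} = (if i then minimalPeriod g x else 0) +
      (if j then minimalPeriod g y else 0) + if k then minimalPeriod g z else 0 := by
  have hpow : ∀ k : ℕ, ∀ w, p w → p ((g ^ k) w) := by
    intro k
    induction k with
    | zero => simp
    | succ k ih => intro w hw; rw [pow_succ', mul_apply]; exact hp _ (ih w hw)
  have key : ∀ c, ∃ i : Bool, #{w | p w ∧ g.SameCycle c w} =
      if i then minimalPeriod g c else 0 := by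
    intro c
    by_cases hc : ∃ w, p w ∧ g.SameCycle c w
    · obtain ⟨w, hw, hcw⟩ := hc
      refine ⟨true, ?_⟩
      rw [if_pos rfl, ← card_sameCycle_eq_minimalPeriod]
      congr 1
      ext u
      simp only [mem_filter, mem_univ, true_and, and_iff_right_iff_imp]
      intro hu
      obtain ⟨k, -, -, rfl⟩ := (hcw.symm.trans hu).exists_pow_eq''
      exact hpow k w hw
    · push Not at hc
      refine ⟨false, ?_⟩
      rw [filter_false_of_mem fun w _ h' => hc w h'.1 h'.2]
      simp
  obtain ⟨i, hi⟩ := key x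
  obtain ⟨j, hj⟩ := key y
  obtain ⟨k, hk⟩ := key z
  exact ⟨i, j, k, by rw [h.card_eq_add p, hi, hj, hk]⟩

end Key

section Existence

open Function

theorem Equiv.Perm.sameCycle_permCongr {α β : Type*} (e : α ≃ β) (f : Perm α) {x y : α} :
    (e.permCongr f).SameCycle (e x) (e y) ↔ f.SameCycle x y := by
  refine exists_congr fun k => ?_
  have : (e.permCongr f) ^ k = e.permCongr (f ^ k) := (map_zpow e.permCongrHom f k).symm
  rw [this]
  simp [Equiv.permCongr_apply]

theorem Equiv.Perm.sameCycle_finRotate {m : ℕ} (x y : Fin m) : (finRotate m).SameCycle x y := by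
  match m, x, y with
  | 0, x, _ => exact x.elim0
  | 1, x, y => rw [Subsingleton.elim x y]
  | m + 2, x, y =>
    exact isCycle_finRotate.sameCycle (by rw [← mem_support, support_finRotate]; simp)
      (by rw [← mem_support, support_finRotate]; simp)

theorem Equiv.Perm.sumCongr_zpow {α β : Type*} (f : Perm α) (h : Perm β) (k : ℤ) :
    sumCongr f h ^ k = sumCongr (f ^ k) (h ^ k) :=
  (map_zpow (sumCongrHom α β) (f, h) k).symm

theorem Equiv.Perm.sameCycle_sumCongr_inl {α β : Type*} (f : Perm α) (h : Perm β) {x : α}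
    {w : α ⊕ β} : (sumCongr f h).SameCycle (Sum.inl x) w ↔
      ∃ y, f.SameCycle x y ∧ Sum.inl y = w := by
  constructor
  · rintro ⟨k, rfl⟩
    exact ⟨_, ⟨k, rfl⟩, by rw [sumCongr_zpow]; rfl⟩
  · rintro ⟨_, ⟨k, rfl⟩, rfl⟩
    exact ⟨k, by rw [sumCongr_zpow]; rfl⟩

theorem Equiv.Perm.sameCycle_sumCongr_inr {α β : Type*} (f : Perm α) (h : Perm β) {x : β}
    {w : α ⊕ β} : (sumCongr f h).SameCycle (Sum.inr x) w ↔
      ∃ y, h.SameCycle x y ∧ Sum.inr y = w := by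
  constructor
  · rintro ⟨k, rfl⟩
    exact ⟨_, ⟨k, rfl⟩, by rw [sumCongr_zpow]; rfl⟩
  · rintro ⟨_, ⟨k, rfl⟩, rfl⟩
    exact ⟨k, by rw [sumCongr_zpow]; rfl⟩

theorem HasThreeCycles.permCongr {α β : Type*} {g : Perm α} {x y z : α}
    (h : HasThreeCycles g x y z) (e : α ≃ β) :
    HasThreeCycles (e.permCongr g) (e x) (e y) (e z) := by
  refine ⟨?_, ?_, ?_, fun w => ?_⟩
  · rw [sameCycle_permCongr]; exact h.not_xy
  · rw [sameCycle_permCongr]; exact h.not_xz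
  · rw [sameCycle_permCongr]; exact h.not_yz
  · obtain ⟨w, rfl⟩ := e.surjective w
    simp only [sameCycle_permCongr]
    exact h.cover w

theorem Equiv.Perm.minimalPeriod_permCongr {α β : Type*} [Fintype α] [DecidableEq α] [Fintype β]
    [DecidableEq β] (e : α ≃ β) (g : Perm α) (x : α) :
    minimalPeriod (e.permCongr g) (e x) = minimalPeriod g x := by
  rw [← card_sameCycle_eq_minimalPeriod, ← card_sameCycle_eq_minimalPeriod]
  symm
  refine card_bijective e e.bijective fun w => ?_
  simp only [mem_filter, mem_univ, true_and, sameCycle_permCongr]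

theorem exists_hasThreeCycles {n a b c : ℕ} (ha : 0 < a) (hb : 0 < b) (hc : 0 < c)
    (hn : a + b + c = n) : ∃ (g : Perm (Fin n)) (x y z : Fin n), HasThreeCycles g x y z ∧
      minimalPeriod g x = a ∧ minimalPeriod g y = b ∧ minimalPeriod g z = c ∧
      sign g = (-1) ^ (n + 1) := by
  obtain ⟨a, rfl⟩ : ∃ k, a = k + 1 := ⟨a - 1, by omega⟩
  obtain ⟨b, rfl⟩ : ∃ k, b = k + 1 := ⟨b - 1, by omega⟩
  obtain ⟨c, rfl⟩ : ∃ k, c = k + 1 := ⟨c - 1, by omega⟩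
  let f : Perm (Fin (a + 1) ⊕ Fin (b + 1) ⊕ Fin (c + 1)) :=
    Perm.sumCongr (finRotate _) (Perm.sumCongr (finRotate _) (finRotate _))
  have e : Fin (a + 1) ⊕ Fin (b + 1) ⊕ Fin (c + 1) ≃ Fin n :=
    Fintype.equivFinOfCardEq (by simp [← hn, add_assoc])
  have hf : HasThreeCycles f (Sum.inl 0) (Sum.inr (Sum.inl 0)) (Sum.inr (Sum.inr 0)) := by
    refine ⟨?_, ?_, ?_, ?_⟩
    · simp [f, sameCycle_sumCongr_inl]
    · simp [f, sameCycle_sumCongr_inl]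
    · simp [f, sameCycle_sumCongr_inl, sameCycle_sumCongr_inr]
    · rintro (w | w | w) <;>
        simp [f, sameCycle_sumCongr_inl, sameCycle_sumCongr_inr, sameCycle_finRotate]
  have hcard : ∀ {m : ℕ} (i : Fin m ↪ Fin (a + 1) ⊕ Fin (b + 1) ⊕ Fin (c + 1)) (x),
      (∀ w, f.SameCycle x w ↔ ∃ y, i y = w) → minimalPeriod f x = m := by
    intro m i x h
    rw [← card_sameCycle_eq_minimalPeriod]
    have : ({w | f.SameCycle x w} : Finset _) = univ.map i := by
      ext w
      simp [h]
    rw [this, card_map, card_univ, Fintype.card_fin]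
  refine ⟨e.permCongr f, _, _, _, hf.permCongr e, ?_, ?_, ?_, ?_⟩
  · rw [minimalPeriod_permCongr]
    refine hcard Embedding.inl _ fun w => ?_
    simp [f, sameCycle_sumCongr_inl, sameCycle_finRotate]
  · rw [minimalPeriod_permCongr]
    refine hcard (Embedding.inl.trans Embedding.inr) _ fun w => ?_
    simp [f, sameCycle_sumCongr_inl, sameCycle_sumCongr_inr, sameCycle_finRotate]
  · rw [minimalPeriod_permCongr]
    refine hcard (Embedding.inr.trans Embedding.inr) _ fun w => ?_
    simp [f, sameCycle_sumCongr_inr, sameCycle_finRotate]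
  · rw [sign_permCongr, sign_sumCongr, sign_sumCongr, sign_finRotate, sign_finRotate,
      sign_finRotate, ← pow_add, ← pow_add, ← hn]
    rw [show a + 1 + (b + 1) + (c + 1) + 1 = a + (b + c) + 2 * 2 by ring, pow_add _ _ (2 * 2),
      pow_mul]
    simp

end Existence

section Covering

open Function

/-- If every good three-cycle type occurs in a member of a finite family of permutation groups not
containing the alternating group, then the orbit lengths give a small set meeting all good
triples. -/
theorem exists_hitting_set {n s R : ℕ} (hn : 100000 ≤ n) (hR1 : 25 * (n : ℝ) ≤ (R : ℝ) ^ 2)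
    (hR2 : 512 * (n : ℝ) ^ 2 ≤ 1000 * ((R : ℝ) ^ 2 * (R - 2)))
    (L : Fin s → Subgroup (Perm (Fin n)))
    (hL : ∀ (g : Perm (Fin n)) (x y z : Fin n), HasThreeCycles g x y z →
      sign g = (-1) ^ (n + 1) →
      ∃ i, ∃ t : Perm (Fin n), t * g * t⁻¹ ∈ L i ∧ ¬ alternatingGroup (Fin n) ≤ L i) :
    ∃ S : Finset ℕ, #S ≤ 2 * s ∧ (∀ k ∈ S, 0 < k ∧ k < n ∧ n - k ∈ S) ∧
      ∀ a b c, 0 < a → 0 < b → 0 < c → a + b + c = n → IsGoodTriple R a b c →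
        a ∈ S ∨ b ∈ S ∨ c ∈ S := by
  classical
  let k : Fin s → ℕ := fun i => if h : ∃ a : Fin n, ∃ b, ¬ ∃ t ∈ L i, t a = b then
    #{w | ∃ t ∈ L i, t h.choose = w} else 1
  have hk : ∀ i, 0 < k i ∧ k i < n := by
    intro i
    simp only [k]
    split_ifs with h
    · refine ⟨card_pos.mpr ⟨h.choose, ?_⟩, ?_⟩
      · simp only [mem_filter, mem_univ, true_and]
        exact ⟨1, (L i).one_mem, rfl⟩
      · obtain ⟨b, hb⟩ := h.choose_spec
        have : #({w | ∃ t ∈ L i, t h.choose = w} : Finset (Fin n)) < #(univ : Finset (Fin n)) :=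
          card_lt_card ⟨subset_univ _, fun h' => hb (by simpa using h' (mem_univ b))⟩
        simpa using this
    · omega
  refine ⟨univ.image k ∪ univ.image fun i => n - k i, ?_, ?_, ?_⟩
  · refine (card_union_le _ _).trans ?_
    have h1 : #(univ.image k) ≤ s := card_image_le.trans (by simp)
    have h2 : #(univ.image fun i => n - k i) ≤ s := card_image_le.trans (by simp)
    omega
  · intro m hm
    simp only [mem_union, mem_image, mem_univ, true_and] at hm ⊢
    rcases hm with ⟨i, rfl⟩ | ⟨i, rfl⟩
    · exact ⟨(hk i).1, (hk i).2, Or.inr ⟨i, rfl⟩⟩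
    · have := hk i
      exact ⟨by omega, by omega, Or.inl ⟨i, by omega⟩⟩
  · intro a b c ha hb hc habc hgood
    obtain ⟨g, x, y, z, hg, rfl, rfl, rfl, hsign⟩ := exists_hasThreeCycles ha hb hc habc
    obtain ⟨i, t, htg, hLi⟩ := hL g x y z hg hsign
    have hconj : t * g * t⁻¹ = t.permCongr g := by
      ext w
      simp [Perm.inv_def]
    rw [hconj] at htg
    have hg' := hg.permCongr t
    have hx := minimalPeriod_permCongr t g x
    have hy := minimalPeriod_permCongr t g y
    have hz := minimalPeriod_permCongr t g z
    have hintrans : ∃ a : Fin n, ∃ b, ¬ ∃ t ∈ L i, t a = b := by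
      by_contra! hcon
      refine hLi (hg'.alternatingGroup_le (R := R) ?_ htg hcon (by simpa using hn)
        (by simpa using hR1)
        (by simpa using hR2))
      rw [hx, hy, hz]
      exact hgood
    obtain ⟨p, q, r, hpqr⟩ := hg'.card_invariant
      (p := fun w => ∃ t ∈ L i, t hintrans.choose = w) (by
      rintro _ ⟨u, hu, rfl⟩
      exact ⟨_ * u, (L i).mul_mem htg hu, rfl⟩)
    have hki : k i = #({w | ∃ t ∈ L i, t hintrans.choose = w} : Finset (Fin n)) := dif_pos hintrans
    replace hpqr := hki.trans (Eq.trans (by congr) hpqr)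
    rw [hx, hy, hz] at hpqr
    have := hk i
    simp only [mem_union, mem_image, mem_univ, true_and]
    have h1 : ∀ m, k i = m → ((∃ a, k a = m) ∨ ∃ a, n - k a = m) := fun m h => Or.inl ⟨i, h⟩
    have h2 : ∀ m, n - k i = m → ((∃ a, k a = m) ∨ ∃ a, n - k a = m) := fun m h => Or.inr ⟨i, h⟩
    cases p <;> cases q <;> cases r <;> simp only [if_true, if_false, Bool.false_eq_true] at hpqr
    · omega
    · exact Or.inr (Or.inr (h1 _ (by omega)))
    · exact Or.inr (Or.inl (h1 _ (by omega)))
    · exact Or.inl (h2 _ (by omega))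
    · exact Or.inl (h1 _ (by omega))
    · exact Or.inr (Or.inl (h2 _ (by omega)))
    · exact Or.inr (Or.inr (h2 _ (by omega)))
    · omega

end Covering

end

section

open Finset

/-- Ordered pairs `(a, b)` of positive integers with `a + b < n`. -/
def posPairs (n : ℕ) : Finset (ℕ × ℕ) :=
  {p ∈ range n ×ˢ range n | 0 < p.1 ∧ 0 < p.2 ∧ p.1 + p.2 < n}

theorem mem_posPairs {n : ℕ} {p : ℕ × ℕ} :
    p ∈ posPairs n ↔ 0 < p.1 ∧ 0 < p.2 ∧ p.1 + p.2 < n := by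
  simp only [posPairs, mem_filter, mem_product, mem_range]
  omega

theorem two_mul_card_posPairs_le (m : ℕ) : 2 * #(posPairs (m + 1)) ≤ m ^ 2 := by
  have h1 : #((posPairs (m + 1)).image fun p => (p.1 - 1, p.2 - 1)) = #(posPairs (m + 1)) := by
    refine card_image_of_injOn fun p hp q hq h => ?_
    simp only [Prod.mk.injEq, Finset.mem_coe, mem_posPairs] at *
    ext <;> omega
  have h2 : #((posPairs (m + 1)).image fun p => (m - p.1, m - p.2)) = #(posPairs (m + 1)) := by
    refine card_image_of_injOn fun p hp q hq h => ?_
    simp only [Prod.mk.injEq, Finset.mem_coe, mem_posPairs] at *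
    ext <;> omega
  have h3 : Disjoint ((posPairs (m + 1)).image fun p => (p.1 - 1, p.2 - 1))
      ((posPairs (m + 1)).image fun p => (m - p.1, m - p.2)) := by
    rw [disjoint_left]
    intro x hx hy
    simp only [mem_image, mem_posPairs] at hx hy
    obtain ⟨p, hp, rfl⟩ := hx
    obtain ⟨q, hq, h⟩ := hy
    simp only [Prod.mk.injEq] at h
    omega
  calc 2 * #(posPairs (m + 1)) = _ + _ := two_mul _
    _ = _ := by nth_rewrite 1 [← h1]; rw [← h2, ← card_union_of_disjoint h3]
    _ ≤ #(range m ×ˢ range m) := by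
      refine card_le_card fun x hx => ?_
      simp only [mem_union, mem_image, mem_posPairs, mem_product, mem_range] at hx ⊢
      rcases hx with ⟨p, hp, rfl⟩ | ⟨p, hp, rfl⟩ <;> constructor <;> simp only <;> omega
    _ = m ^ 2 := by simp [sq]

theorem card_posPairs_filter_fst_third_le (n : ℕ) (P : ℕ → ℕ → Prop) [DecidableRel P] :
    #{p ∈ posPairs n | P p.1 (n - p.1 - p.2)} ≤ #{p ∈ posPairs n | P p.1 p.2} := by
  refine card_le_card_of_injOn (fun p => (p.1, n - p.1 - p.2)) (fun p hp => ?_)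
    fun p hp q hq h => ?_
  · simp only [Finset.mem_coe, mem_filter, mem_posPairs] at *
    exact ⟨by omega, hp.2⟩
  · simp only [Finset.mem_coe, mem_filter, mem_posPairs, Prod.mk.injEq] at *
    ext <;> omega

theorem card_posPairs_filter_snd_third_le (n : ℕ) (P : ℕ → ℕ → Prop) [DecidableRel P] :
    #{p ∈ posPairs n | P p.2 (n - p.1 - p.2)} ≤ #{p ∈ posPairs n | P p.1 p.2} := by
  refine card_le_card_of_injOn (fun p => (p.2, n - p.1 - p.2)) (fun p hp => ?_)
    fun p hp q hq h => ?_
  · simp only [Finset.mem_coe, mem_filter, mem_posPairs] at *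
    exact ⟨by omega, hp.2⟩
  · simp only [Finset.mem_coe, mem_filter, mem_posPairs, Prod.mk.injEq] at *
    ext <;> omega

theorem card_posPairs_dvd_le {n h : ℕ} (hn : 0 < n) (hh : 0 < h) :
    2 * #{p ∈ posPairs n | h ∣ p.1 ∧ h ∣ p.2} ≤ ((n - 1) / h) ^ 2 := by
  refine le_trans (Nat.mul_le_mul_left 2 ?_) (two_mul_card_posPairs_le ((n - 1) / h))
  refine card_le_card_of_injOn (fun p => (p.1 / h, p.2 / h)) (fun p hp => ?_) fun p hp q hq e => ?_
  · simp only [Finset.mem_coe, mem_filter, mem_posPairs] at *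
    obtain ⟨⟨h1, h2, h3⟩, h4, h5⟩ := hp
    refine ⟨Nat.div_pos (Nat.le_of_dvd h1 h4) hh, Nat.div_pos (Nat.le_of_dvd h2 h5) hh, ?_⟩
    rw [Nat.lt_succ_iff, ← Nat.add_div_of_dvd_right h4]
    exact Nat.div_le_div_right (by omega)
  · simp only [Finset.mem_coe, mem_filter, Prod.mk.injEq] at *
    obtain ⟨-, h1, h2⟩ := hp
    obtain ⟨-, h3, h4⟩ := hq
    ext
    · exact (Nat.div_left_inj h1 h3).mp e.1
    · exact (Nat.div_left_inj h2 h4).mp e.2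

theorem card_posPairs_lt_gcd_le {n H : ℕ} (hn : 0 < n) (hH : 0 < H) :
    (#{p ∈ posPairs n | H < p.1.gcd p.2} : ℝ) ≤ (n : ℝ) ^ 2 / (2 * H) := by
  rcases le_or_gt n H with hnH | hnH
  · rw [filter_false_of_mem]
    · simp; positivity
    · intro p hp h
      rw [mem_posPairs] at hp
      have := Nat.le_of_dvd hp.1 (Nat.gcd_dvd_left p.1 p.2)
      omega
  have hsub : ({p ∈ posPairs n | H < p.1.gcd p.2} : Finset (ℕ × ℕ)) ⊆
      (Ioc H n).biUnion fun h => {p ∈ posPairs n | h ∣ p.1 ∧ h ∣ p.2} := by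
    intro p hp
    simp only [mem_filter, mem_biUnion, mem_Ioc, mem_posPairs] at hp ⊢
    have := Nat.le_of_dvd hp.1.1 (Nat.gcd_dvd_left p.1 p.2)
    exact ⟨p.1.gcd p.2, ⟨hp.2, by omega⟩, hp.1, Nat.gcd_dvd_left _ _, Nat.gcd_dvd_right _ _⟩
  calc (#{p ∈ posPairs n | H < p.1.gcd p.2} : ℝ)
      ≤ ∑ h ∈ Ioc H n, (#{p ∈ posPairs n | h ∣ p.1 ∧ h ∣ p.2} : ℝ) := by
        exact_mod_cast (card_le_card hsub).trans card_biUnion_le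
    _ ≤ ∑ h ∈ Ioc H n, (n : ℝ) ^ 2 / 2 * ((h : ℝ) ^ 2)⁻¹ := by
        refine sum_le_sum fun h hh => ?_
        rw [mem_Ioc] at hh
        have h0 : 0 < h := by omega
        have h1 : (2 * #{p ∈ posPairs n | h ∣ p.1 ∧ h ∣ p.2} : ℝ) ≤ ((n - 1) / h : ℕ) ^ 2 := by
          exact_mod_cast card_posPairs_dvd_le hn h0
        have h2 : (((n - 1) / h : ℕ) : ℝ) ≤ n / h :=
          (Nat.cast_div_le).trans (by gcongr; omega)
        have h3 : (((n - 1) / h : ℕ) : ℝ) ^ 2 ≤ (n / h) ^ 2 := by gcongr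
        rw [div_pow, div_eq_mul_inv] at h3
        linarith
    _ ≤ (n : ℝ) ^ 2 / 2 * (H : ℝ)⁻¹ := by
        rw [← mul_sum]
        gcongr
        refine (sum_Ioc_inv_sq_le_sub hH.ne' hnH.le).trans ?_
        simp
    _ = _ := by field_simp

theorem card_posPairs_mul_gcd_le {n h R : ℕ} (hh : 0 < h) :
    #{p ∈ posPairs n | p.1.gcd p.2 = h ∧ min p.1 p.2 < R * h} ≤ 2 * (R * (n / h)) := by
  have key : ∀ f : ℕ × ℕ → ℕ × ℕ, (∀ p, f p = p) ∨ (∀ p, f p = p.swap) →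
      #{p ∈ posPairs n | p.1.gcd p.2 = h ∧ (f p).1 < R * h} ≤ R * (n / h) := by
    intro f hf
    have hc : R * (n / h) = #(range R ×ˢ Ioc 0 (n / h)) := by simp
    rw [hc]
    refine card_le_card_of_injOn (fun p => ((f p).1 / h, (f p).2 / h)) (fun p hp => ?_)
      fun p hp q hq e => ?_
    · simp only [Finset.mem_coe, mem_filter, mem_posPairs, mem_product, mem_range, mem_Ioc] at *
      obtain ⟨⟨h1, h2, h3⟩, h4, h5⟩ := hp
      have d1 : h ∣ p.1 := h4 ▸ Nat.gcd_dvd_left _ _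
      have d2 : h ∣ p.2 := h4 ▸ Nat.gcd_dvd_right _ _
      refine ⟨(Nat.div_lt_iff_lt_mul hh).mpr h5, ?_⟩
      rcases hf with hf | hf <;> rw [hf]
      · exact ⟨Nat.div_pos (Nat.le_of_dvd h2 d2) hh, Nat.div_le_div_right (by omega)⟩
      · exact ⟨Nat.div_pos (Nat.le_of_dvd h1 d1) hh, Nat.div_le_div_right (by simp; omega)⟩
    · simp only [Finset.mem_coe, mem_filter, Prod.mk.injEq] at *
      obtain ⟨-, h1, -⟩ := hp
      obtain ⟨-, h2, -⟩ := hq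
      have d1 : h ∣ p.1 := h1 ▸ Nat.gcd_dvd_left _ _
      have d2 : h ∣ p.2 := h1 ▸ Nat.gcd_dvd_right _ _
      have d3 : h ∣ q.1 := h2 ▸ Nat.gcd_dvd_left _ _
      have d4 : h ∣ q.2 := h2 ▸ Nat.gcd_dvd_right _ _
      rcases hf with hf | hf <;> rw [hf, hf] at e
      · exact Prod.ext ((Nat.div_left_inj d1 d3).mp e.1) ((Nat.div_left_inj d2 d4).mp e.2)
      · exact Prod.ext ((Nat.div_left_inj d1 d3).mp e.2) ((Nat.div_left_inj d2 d4).mp e.1)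
  refine le_trans ?_ ((add_le_add (key id (Or.inl fun _ => rfl))
    (key Prod.swap (Or.inr fun _ => rfl))).trans_eq (two_mul _).symm)
  refine le_trans (card_le_card ?_) (card_union_le _ _)
  intro p hp
  simp only [mem_filter, mem_union, min_lt_iff, id, Prod.fst_swap] at hp ⊢
  tauto

theorem card_posPairs_min_lt_le {n R H : ℕ} (hn : 0 < n) (hH : 0 < H) :
    (#{p ∈ posPairs n | min p.1 p.2 < R * p.1.gcd p.2} : ℝ) ≤
      2 * R * n * (1 + Real.log H) + (n : ℝ) ^ 2 / (2 * H) := by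
  have hsub : ({p ∈ posPairs n | min p.1 p.2 < R * p.1.gcd p.2} : Finset (ℕ × ℕ)) ⊆
      ((Icc 1 H).biUnion fun h => {p ∈ posPairs n | p.1.gcd p.2 = h ∧ min p.1 p.2 < R * h}) ∪
        {p ∈ posPairs n | H < p.1.gcd p.2} := by
    intro p hp
    simp only [mem_filter, mem_union, mem_biUnion, mem_Icc] at hp ⊢
    rcases lt_or_ge H (p.1.gcd p.2) with h | h
    · exact Or.inr ⟨hp.1, h⟩
    · exact Or.inl ⟨_, ⟨Nat.gcd_pos_of_pos_left _ (mem_posPairs.mp hp.1).1, h⟩, hp.1, rfl, hp.2⟩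
  have h1 : (#{p ∈ posPairs n | min p.1 p.2 < R * p.1.gcd p.2} : ℝ) ≤
      ∑ h ∈ Icc 1 H, (#{p ∈ posPairs n | p.1.gcd p.2 = h ∧ min p.1 p.2 < R * h} : ℝ) +
        (#{p ∈ posPairs n | H < p.1.gcd p.2} : ℝ) := by
    exact_mod_cast (card_le_card hsub).trans ((card_union_le _ _).trans
      (Nat.add_le_add_right card_biUnion_le _))
  refine h1.trans (add_le_add ?_ (card_posPairs_lt_gcd_le hn hH))
  calc ∑ h ∈ Icc 1 H, (#{p ∈ posPairs n | p.1.gcd p.2 = h ∧ min p.1 p.2 < R * h} : ℝ)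
      ≤ ∑ h ∈ Icc 1 H, 2 * R * n * (h : ℝ)⁻¹ := by
        refine sum_le_sum fun h hh => ?_
        have h2 : (#{p ∈ posPairs n | p.1.gcd p.2 = h ∧ min p.1 p.2 < R * h} : ℝ) ≤
            2 * (R * (n / h : ℕ)) := by
          exact_mod_cast card_posPairs_mul_gcd_le (mem_Icc.mp hh).1
        refine h2.trans ?_
        have h3 : ((n / h : ℕ) : ℝ) ≤ n / h := Nat.cast_div_le
        rw [div_eq_mul_inv] at h3
        calc (2 * (R * (n / h : ℕ)) : ℝ) ≤ 2 * (R * (n * (h : ℝ)⁻¹)) := by gcongr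
          _ = _ := by ring
    _ = 2 * R * n * (harmonic H : ℝ) := by
        rw [← mul_sum, harmonic_eq_sum_Icc]
        push_cast
        rfl
    _ ≤ _ := by
        gcongr
        exact harmonic_le_one_add_log H

theorem card_posPairs_div_gcd_dvd_le {n : ℕ} (hn : 0 < n) :
    #{p ∈ posPairs n | (p.1 + p.2) / p.1.gcd p.2 ∣ n} ≤ n * #n.divisors := by
  have hc : #(n.divisors.sigma fun k => range (n / k) ×ˢ range k) = n * #n.divisors := by
    rw [card_sigma, mul_comm, ← smul_eq_mul, ← sum_const]
    refine sum_congr rfl fun k hk => ?_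
    rw [card_product, card_range, card_range, Nat.div_mul_cancel (Nat.dvd_of_mem_divisors hk)]
  rw [← hc]
  refine card_le_card_of_injOn (fun p => ⟨(p.1 + p.2) / p.1.gcd p.2, p.1.gcd p.2,
    p.1 / p.1.gcd p.2⟩) (fun p hp => ?_) fun p hp q hq e => ?_
  · simp only [Finset.mem_coe, mem_filter, mem_posPairs, mem_sigma, mem_product, mem_range,
      Nat.mem_divisors] at *
    obtain ⟨⟨h1, h2, h3⟩, h4⟩ := hp
    have hg : 0 < p.1.gcd p.2 := Nat.gcd_pos_of_pos_left _ h1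
    have hs : p.1.gcd p.2 ∣ p.1 + p.2 := dvd_add (Nat.gcd_dvd_left _ _) (Nat.gcd_dvd_right _ _)
    have hk : 0 < (p.1 + p.2) / p.1.gcd p.2 := Nat.pos_of_dvd_of_pos h4 hn
    refine ⟨⟨h4, hn.ne'⟩, ?_, ?_⟩
    · rw [Nat.lt_div_iff_mul_lt' h4, Nat.div_mul_cancel hs]
      exact h3
    · exact Nat.div_lt_div_of_lt_of_dvd hs (by omega)
  · simp only [Finset.mem_coe, mem_filter, mem_posPairs, Sigma.mk.injEq, heq_eq_eq,
      Prod.mk.injEq] at *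
    obtain ⟨e1, e2, e3⟩ := e
    have d1 : p.1.gcd p.2 ∣ p.1 + p.2 := dvd_add (Nat.gcd_dvd_left _ _) (Nat.gcd_dvd_right _ _)
    have d2 : p.1.gcd p.2 ∣ q.1 + q.2 :=
      e2 ▸ dvd_add (Nat.gcd_dvd_left _ _) (Nat.gcd_dvd_right _ _)
    have d3 : p.1.gcd p.2 ∣ p.1 := Nat.gcd_dvd_left _ _
    have d4 : p.1.gcd p.2 ∣ q.1 := e2 ▸ Nat.gcd_dvd_left _ _
    rw [← e2] at e1 e3
    have f1 := (Nat.div_left_inj d1 d2).mp e1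
    have f2 := (Nat.div_left_inj d3 d4).mp e3
    exact Prod.ext f2 (by omega)

theorem card_no_common_prime (Q : Finset ℕ) (hQ : ∀ q ∈ Q, q.Prime) :
    ∀ n : ℕ, (∀ q ∈ Q, q ∣ n) → 0 < n →
      (#{p ∈ range n ×ˢ range n | ∀ q ∈ Q, ¬ (q ∣ p.1 ∧ q ∣ p.2)} : ℝ) =
        (n : ℝ) ^ 2 * ∏ q ∈ Q, (1 - ((q : ℝ) ^ 2)⁻¹) := by
  induction Q using Finset.induction_on with
  | empty => intro n _ _; simp [sq]
  | insert l Q hl ih =>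
    intro n hn hn0
    have hl0 : 0 < l := (hQ l (mem_insert_self l Q)).pos
    obtain ⟨m, rfl⟩ := hn l (mem_insert_self l Q)
    have hm0 : 0 < m := Nat.pos_of_mul_pos_left hn0
    have hQ' : ∀ q ∈ Q, q.Prime := fun q hq => hQ q (mem_insert_of_mem hq)
    have hcop : ∀ q ∈ Q, q.Coprime l := fun q hq =>
      (Nat.coprime_primes (hQ' q hq) (hQ l (mem_insert_self l Q))).mpr fun h => hl (h ▸ hq)
    have hm : ∀ q ∈ Q, q ∣ m := fun q hq =>
      (hcop q hq).dvd_of_dvd_mul_left (hn q (mem_insert_of_mem hq))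
    have h1 := ih hQ' (l * m) (fun q hq => hn q (mem_insert_of_mem hq)) hn0
    have h2 := ih hQ' m hm hm0
    have hbij : #{p ∈ range m ×ˢ range m | ∀ q ∈ Q, ¬ (q ∣ p.1 ∧ q ∣ p.2)} =
        #{p ∈ range (l * m) ×ˢ range (l * m) |
          (∀ q ∈ Q, ¬ (q ∣ p.1 ∧ q ∣ p.2)) ∧ (l ∣ p.1 ∧ l ∣ p.2)} := by
      refine card_bij (fun p _ => (l * p.1, l * p.2)) ?_ ?_ ?_
      · intro p hp
        simp only [mem_filter, mem_product, mem_range] at hp ⊢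
        refine ⟨⟨Nat.mul_lt_mul_of_pos_left hp.1.1 hl0, Nat.mul_lt_mul_of_pos_left hp.1.2 hl0⟩,
          fun q hq h => hp.2 q hq ?_, dvd_mul_right _ _, dvd_mul_right _ _⟩
        exact ⟨(hcop q hq).dvd_of_dvd_mul_left h.1, (hcop q hq).dvd_of_dvd_mul_left h.2⟩
      · intro p _ q _ h
        simp only [Prod.mk.injEq] at h
        exact Prod.ext (Nat.eq_of_mul_eq_mul_left hl0 h.1) (Nat.eq_of_mul_eq_mul_left hl0 h.2)
      · rintro ⟨_, _⟩ hp
        simp only [mem_filter, mem_product, mem_range] at hp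
        obtain ⟨⟨h3, h4⟩, h5, ⟨a, rfl⟩, ⟨b, rfl⟩⟩ := hp
        refine ⟨(a, b), ?_, rfl⟩
        simp only [mem_filter, mem_product, mem_range]
        exact ⟨⟨Nat.lt_of_mul_lt_mul_left h3, Nat.lt_of_mul_lt_mul_left h4⟩,
          fun q hq h => h5 q hq ⟨h.1.mul_left l, h.2.mul_left l⟩⟩
    have hsplit : #{p ∈ range (l * m) ×ˢ range (l * m) | ∀ q ∈ Q, ¬ (q ∣ p.1 ∧ q ∣ p.2)} =
        #{p ∈ range (l * m) ×ˢ range (l * m) |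
          (∀ q ∈ Q, ¬ (q ∣ p.1 ∧ q ∣ p.2)) ∧ (l ∣ p.1 ∧ l ∣ p.2)} +
        #{p ∈ range (l * m) ×ˢ range (l * m) |
          ∀ q ∈ insert l Q, ¬ (q ∣ p.1 ∧ q ∣ p.2)} := by
      rw [← card_filter_add_card_filter_not (fun p : ℕ × ℕ => l ∣ p.1 ∧ l ∣ p.2),
        filter_filter, filter_filter]
      congr 2
      ext p
      simp only [mem_filter, forall_mem_insert]
      tauto
    rw [← hbij] at hsplit
    have hsplit' : (#{p ∈ range (l * m) ×ˢ range (l * m) | ∀ q ∈ Q, ¬ (q ∣ p.1 ∧ q ∣ p.2)} : ℝ) =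
        #{p ∈ range m ×ˢ range m | ∀ q ∈ Q, ¬ (q ∣ p.1 ∧ q ∣ p.2)} +
        #{p ∈ range (l * m) ×ˢ range (l * m) |
          ∀ q ∈ insert l Q, ¬ (q ∣ p.1 ∧ q ∣ p.2)} := by exact_mod_cast hsplit
    rw [h1, h2] at hsplit'
    have hlr : (l : ℝ) ≠ 0 := by exact_mod_cast hl0.ne'
    rw [prod_insert hl]
    push_cast at hsplit' ⊢
    have e : ((l : ℝ) * m) ^ 2 * ((1 - ((l : ℝ) ^ 2)⁻¹) * ∏ q ∈ Q, (1 - ((q : ℝ) ^ 2)⁻¹)) =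
        ((l : ℝ) * m) ^ 2 * ∏ q ∈ Q, (1 - ((q : ℝ) ^ 2)⁻¹) -
          (m : ℝ) ^ 2 * ∏ q ∈ Q, (1 - ((q : ℝ) ^ 2)⁻¹) := by
      field_simp
    rw [e]
    linarith

theorem prod_one_sub_inv_sq_ge (Q : Finset ℕ) (hQ : ∀ q ∈ Q, q.Prime) :
    6 / Real.pi ^ 2 ≤ ∏ q ∈ Q, (1 - ((q : ℝ) ^ 2)⁻¹) := by
  let f : ℕ →* ℝ :=
    { toFun := fun n => ((n : ℝ) ^ 2)⁻¹
      map_one' := by simp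
      map_mul' := fun a b => by push_cast; rw [mul_pow, mul_inv] }
  have hz : HasSum f (Real.pi ^ 2 / 6) := by
    have := hasSum_zeta_two
    simp only [one_div] at this
    exact this
  have h1 := EulerProduct.prod_filter_prime_geometric_eq_tsum_factoredNumbers hz.summable Q
  rw [filter_true_of_mem hQ] at h1
  have h2 : ∑' m : Nat.factoredNumbers Q, f m ≤ Real.pi ^ 2 / 6 := by
    rw [← hz.tsum_eq]
    exact hz.summable.tsum_subtype_le f _ fun n => by
      simp only [f, MonoidHom.coe_mk, OneHom.coe_mk]; positivity
  rw [← h1, prod_inv_distrib] at h2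
  have hpos : 0 < ∏ q ∈ Q, (1 - f q) := by
    refine prod_pos fun q hq => sub_pos.mpr ?_
    have : (1 : ℝ) < q := by exact_mod_cast (hQ q hq).one_lt
    exact inv_lt_one_of_one_lt₀ (by nlinarith)
  have h3 := inv_anti₀ (inv_pos.mpr hpos) h2
  rw [inv_inv, inv_div] at h3
  exact h3

theorem two_mul_card_posPairs_common_prime_le {n : ℕ} (hn : 0 < n) :
    (2 * #{p ∈ posPairs n | ∃ q ∈ n.primeFactors, q ∣ p.1 ∧ q ∣ p.2} : ℝ) ≤
      (n : ℝ) ^ 2 * (1 - 6 / Real.pi ^ 2) := by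
  set C : Finset (ℕ × ℕ) := {p ∈ posPairs n | ∃ q ∈ n.primeFactors, q ∣ p.1 ∧ q ∣ p.2} with hC
  have hCmem : ∀ p, p ∈ C ↔ (0 < p.1 ∧ 0 < p.2 ∧ p.1 + p.2 < n) ∧
      ∃ q ∈ n.primeFactors, q ∣ p.1 ∧ q ∣ p.2 := fun p => by rw [hC, mem_filter, mem_posPairs]
  have h1 : #(C.image fun p => (n - p.1, n - p.2)) = #C := by
    refine card_image_of_injOn fun p hp q hq h => ?_
    simp only [Prod.mk.injEq, Finset.mem_coe, hCmem] at *
    ext <;> omega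
  have h2 : Disjoint C (C.image fun p => (n - p.1, n - p.2)) := by
    rw [disjoint_left]
    intro x hx hy
    simp only [mem_image] at hy
    obtain ⟨q, hq, rfl⟩ := hy
    rw [hCmem] at hx hq
    simp only at hx
    omega
  have h3 : 2 * #C ≤ #{p ∈ range n ×ˢ range n | ¬ ∀ q ∈ n.primeFactors, ¬ (q ∣ p.1 ∧ q ∣ p.2)} := by
    rw [two_mul]
    nth_rewrite 2 [← h1]
    rw [← card_union_of_disjoint h2]
    refine card_le_card fun x hx => ?_
    simp only [mem_filter, mem_product, mem_range, not_forall, not_not, exists_prop]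
    rcases mem_union.mp hx with hx | hx
    · rw [hCmem] at hx
      exact ⟨by omega, hx.2⟩
    · obtain ⟨p, hp, rfl⟩ := mem_image.mp hx
      rw [hCmem] at hp
      obtain ⟨hp, q, hq, hq1, hq2⟩ := hp
      have hqn := Nat.dvd_of_mem_primeFactors hq
      exact ⟨by simp only; omega, q, hq, Nat.dvd_sub hqn hq1, Nat.dvd_sub hqn hq2⟩
  have h4 := card_filter_add_card_filter_not (s := range n ×ˢ range n)
    (fun p : ℕ × ℕ => ∀ q ∈ n.primeFactors, ¬ (q ∣ p.1 ∧ q ∣ p.2))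
  rw [card_product, card_range] at h4
  have hp : ∀ q ∈ n.primeFactors, q.Prime := fun q hq => Nat.prime_of_mem_primeFactors hq
  have h5 := card_no_common_prime n.primeFactors hp n
    (fun q hq => Nat.dvd_of_mem_primeFactors hq) hn
  have h6 : (n : ℝ) ^ 2 * (6 / Real.pi ^ 2) ≤
      (n : ℝ) ^ 2 * ∏ q ∈ n.primeFactors, (1 - ((q : ℝ) ^ 2)⁻¹) := by
    gcongr
    exact prod_one_sub_inv_sq_ge _ hp
  rw [← h5] at h6
  have h4' : (#{p ∈ range n ×ˢ range n | ∀ q ∈ n.primeFactors, ¬ (q ∣ p.1 ∧ q ∣ p.2)} : ℝ) +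
    #{p ∈ range n ×ˢ range n | ¬ ∀ q ∈ n.primeFactors, ¬ (q ∣ p.1 ∧ q ∣ p.2)} = (n : ℝ) ^ 2 := by
    rw [sq]
    exact_mod_cast h4
  have h3' : (2 * #C : ℝ) ≤
    #{p ∈ range n ×ˢ range n | ¬ ∀ q ∈ n.primeFactors, ¬ (q ∣ p.1 ∧ q ∣ p.2)} := by
    exact_mod_cast h3
  linarith

theorem Nat.card_divisors_sq_le (n : ℕ) : #n.divisors ^ 2 ≤ 4 * n := by
  have hsub : n.divisors ⊆ Icc 1 n.sqrt ∪ (Icc 1 n.sqrt).image fun d => n / d := by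
    intro d hd
    rw [Nat.mem_divisors] at hd
    obtain ⟨⟨e, rfl⟩, h0⟩ := hd
    have hd0 : 0 < d := Nat.pos_of_ne_zero (by rintro rfl; simp at h0)
    have he0 : 0 < e := Nat.pos_of_ne_zero (by rintro rfl; simp at h0)
    rw [mem_union, mem_image, mem_Icc]
    rcases le_total d e with h | h
    · exact Or.inl ⟨hd0, Nat.le_sqrt.mpr (Nat.mul_le_mul_left d h)⟩
    · refine Or.inr ⟨e, mem_Icc.mpr ⟨he0, Nat.le_sqrt.mpr (Nat.mul_le_mul_right e h)⟩, ?_⟩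
      exact Nat.mul_div_cancel _ he0
  have h1 : #n.divisors ≤ 2 * n.sqrt := by
    refine (card_le_card hsub).trans ((card_union_le _ _).trans ?_)
    have h := Finset.card_image_le (s := Icc 1 n.sqrt) (f := fun d => n / d)
    rw [Nat.card_Icc] at h ⊢
    omega
  calc #n.divisors ^ 2 ≤ (2 * n.sqrt) ^ 2 := Nat.pow_le_pow_left h1 2
    _ = 4 * n.sqrt ^ 2 := by ring
    _ ≤ 4 * n := Nat.mul_le_mul_left 4 (Nat.sqrt_le' n)

theorem le_two_mul_card_avoiding {n : ℕ} {S : Finset ℕ}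
    (hS : ∀ k ∈ S, 0 < k ∧ k < n ∧ n - k ∈ S) (hn : 2 * #S + 2 ≤ n) :
    (n - 1 - #S) * (n - 2 - 2 * #S) ≤
      2 * #{p ∈ posPairs n | p.1 ∉ S ∧ p.2 ∉ S ∧ n - p.1 - p.2 ∉ S} := by
  have hsymm : ∀ k, 0 < k → k < n → k ∉ S → n - k ∉ S := by
    intro k h1 h2 h3 h4
    have := (hS _ h4).2.2
    rw [Nat.sub_sub_self h2.le] at this
    exact h3 this
  set F : Finset (ℕ × ℕ) := {p ∈ posPairs n | p.1 ∉ S ∧ p.2 ∉ S ∧ n - p.1 - p.2 ∉ S} with hF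
  have hFmem : ∀ p, p ∈ F ↔ (0 < p.1 ∧ 0 < p.2 ∧ p.1 + p.2 < n) ∧ p.1 ∉ S ∧ p.2 ∉ S ∧
      n - p.1 - p.2 ∉ S := fun p => by rw [hF, mem_filter, mem_posPairs]
  let A : Finset ℕ := Ioo 0 n \ S
  have hA : ∀ x, x ∈ A ↔ (0 < x ∧ x < n) ∧ x ∉ S := fun x => by simp [A]
  have hAcard : #A = n - 1 - #S := by
    rw [card_sdiff_of_subset, Nat.card_Ioo, Nat.sub_zero]
    exact fun k hk => mem_Ioo.mpr ⟨(hS k hk).1, (hS k hk).2.1⟩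
  let W : Finset (ℕ × ℕ) := {p ∈ A ×ˢ A | p.1 + p.2 ≠ n ∧ (p.1 + p.2) % n ∉ S}
  have hW : #A * (n - 2 - 2 * #S) ≤ #W := by
    rw [← smul_eq_mul]
    have hsum : #W = ∑ x ∈ A, #{y ∈ A | x + y ≠ n ∧ (x + y) % n ∉ S} := by
      simp only [W, card_filter, sum_product]
    rw [hsum]
    refine card_nsmul_le_sum _ _ _ fun x hx => ?_
    rw [hA] at hx
    have h1 : A ⊆ {y ∈ A | x + y ≠ n ∧ (x + y) % n ∉ S} ∪
        ({n - x} ∪ {y ∈ A | (x + y) % n ∈ S}) := by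
      intro y hy
      simp only [mem_union, mem_filter, mem_singleton, hy, true_and]
      by_cases h2 : x + y = n
      · exact Or.inr (Or.inl (by omega))
      · tauto
    have h2 : #{y ∈ A | (x + y) % n ∈ S} ≤ #S := by
      refine card_le_card_of_injOn (fun y => (x + y) % n) (fun y hy => (mem_filter.mp hy).2) ?_
      intro y hy y' hy' h
      simp only [Finset.mem_coe, mem_filter, hA] at hy hy'
      have h3 : y ≡ y' [MOD n] := Nat.ModEq.add_left_cancel' x h
      exact Nat.ModEq.eq_of_lt_of_lt h3 hy.1.1.2 hy'.1.1.2
    have h3 := (card_le_card h1).trans (card_union_le _ _)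
    have h4 := card_union_le ({n - x} : Finset ℕ) {y ∈ A | (x + y) % n ∈ S}
    rw [card_singleton] at h4
    omega
  rw [← hAcard]
  refine hW.trans ?_
  have hsplit := card_filter_add_card_filter_not (s := W) fun p : ℕ × ℕ => p.1 + p.2 < n
  have hWmem : ∀ p, p ∈ W → ((0 < p.1 ∧ p.1 < n) ∧ p.1 ∉ S) ∧ ((0 < p.2 ∧ p.2 < n) ∧ p.2 ∉ S) ∧
      p.1 + p.2 ≠ n ∧ (p.1 + p.2) % n ∉ S := by
    intro p hp
    simp only [W, mem_filter, mem_product, hA] at hp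
    tauto
  have h1 : #{p ∈ W | p.1 + p.2 < n} ≤ #F := by
    refine card_le_card fun p hp => ?_
    obtain ⟨hp, hlt⟩ := mem_filter.mp hp
    obtain ⟨h1, h2, h3, h4⟩ := hWmem p hp
    rw [Nat.mod_eq_of_lt hlt] at h4
    rw [hFmem, Nat.sub_sub]
    exact ⟨⟨h1.1.1, h2.1.1, hlt⟩, h1.2, h2.2, hsymm _ (by omega) hlt h4⟩
  have h2 : #{p ∈ W | ¬ p.1 + p.2 < n} ≤ #F := by
    refine card_le_card_of_injOn (fun p => (n - p.1, n - p.2)) (fun p hp => ?_)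
      fun p hp q hq h => ?_
    · obtain ⟨hp, hlt⟩ := mem_filter.mp hp
      obtain ⟨h1, h2, h3, h4⟩ := hWmem p hp
      have h5 : (p.1 + p.2) % n = p.1 + p.2 - n := by
        rw [Nat.mod_eq_sub_mod (by omega), Nat.mod_eq_of_lt (by omega)]
      rw [h5] at h4
      rw [Finset.mem_coe, hFmem]
      refine ⟨by simp only; omega, hsymm _ h1.1.1 h1.1.2 h1.2, hsymm _ h2.1.1 h2.1.2 h2.2, ?_⟩
      have h6 : n - (n - p.1) - (n - p.2) = p.1 + p.2 - n := by omega
      rwa [h6]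
    · have hp' := hWmem p (mem_filter.mp hp).1
      have hq' := hWmem q (mem_filter.mp hq).1
      simp only [Prod.mk.injEq] at h
      ext <;> omega
  omega

theorem two_mul_card_two_of_three_le {α : Type*} (s : Finset α) (P Q T : α → Prop)
    [DecidablePred P] [DecidablePred Q] [DecidablePred T] :
    2 * #{x ∈ s | (P x ∧ Q x) ∨ (P x ∧ T x) ∨ (Q x ∧ T x)} ≤
      #{x ∈ s | P x} + #{x ∈ s | Q x} + #{x ∈ s | T x} := by
  simp only [card_filter, mul_sum, ← sum_add_distrib]
  refine sum_le_sum fun x _ => ?_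
  by_cases hP : P x <;> by_cases hQ : Q x <;> by_cases hT : T x <;> simp [hP, hQ, hT]

theorem card_posPairs_balanced_le (n : ℕ) :
    #{p ∈ posPairs n | 8 * n < 25 * p.1 ∧ 8 * n < 25 * p.2 ∧ 8 * n < 25 * (n - p.1 - p.2)} ≤
      (n / 25 + 1) ^ 2 := by
  have hsub : ({p ∈ posPairs n | 8 * n < 25 * p.1 ∧ 8 * n < 25 * p.2 ∧
      8 * n < 25 * (n - p.1 - p.2)} : Finset (ℕ × ℕ)) ⊆
      Ioc (8 * n / 25) (9 * n / 25) ×ˢ Ioc (8 * n / 25) (9 * n / 25) := by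
    intro p hp
    simp only [mem_filter, mem_posPairs, mem_product, mem_Ioc] at hp ⊢
    omega
  refine (card_le_card hsub).trans ?_
  rw [card_product, Nat.card_Ioc, sq]
  have : 9 * n / 25 - 8 * n / 25 ≤ n / 25 + 1 := by omega
  exact Nat.mul_le_mul this this

open Classical in
theorem card_not_isGoodTriple_le {n R : ℕ} (hn : 0 < n) (hR : 0 < R) :
    2 * #{p ∈ posPairs n | ¬ IsGoodTriple R p.1 p.2 (n - p.1 - p.2)} ≤
      2 * #{p ∈ posPairs n | ∃ q ∈ n.primeFactors, q ∣ p.1 ∧ q ∣ p.2} +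
      6 * #{p ∈ posPairs n | (p.1 + p.2) / p.1.gcd p.2 ∣ n} +
      3 * #{p ∈ posPairs n | min p.1 p.2 < R * p.1.gcd p.2} +
      6 * #{p ∈ posPairs n | R - 1 < p.1.gcd p.2} + 2 * (n / 25 + 1) ^ 2 := by
  classical
  have hsub : ({p ∈ posPairs n | ¬ IsGoodTriple R p.1 p.2 (n - p.1 - p.2)} : Finset (ℕ × ℕ)) ⊆
      (({p ∈ posPairs n | ∃ q ∈ n.primeFactors, q ∣ p.1 ∧ q ∣ p.2} ∪
      ({p ∈ posPairs n | (p.1 + p.2) / p.1.gcd p.2 ∣ n} ∪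
        ({p ∈ posPairs n | (p.1 + (n - p.1 - p.2)) / p.1.gcd (n - p.1 - p.2) ∣ n} ∪
        {p ∈ posPairs n | (p.2 + (n - p.1 - p.2)) / p.2.gcd (n - p.1 - p.2) ∣ n}))) ∪
      ({p ∈ posPairs n |
        (min p.1 p.2 < R * p.1.gcd p.2 ∧
          min p.1 (n - p.1 - p.2) < R * p.1.gcd (n - p.1 - p.2)) ∨
        (min p.1 p.2 < R * p.1.gcd p.2 ∧
          min p.2 (n - p.1 - p.2) < R * p.2.gcd (n - p.1 - p.2)) ∨
        (min p.1 (n - p.1 - p.2) < R * p.1.gcd (n - p.1 - p.2) ∧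
          min p.2 (n - p.1 - p.2) < R * p.2.gcd (n - p.1 - p.2))} ∪
      ({p ∈ posPairs n | R - 1 < p.1.gcd p.2} ∪
        ({p ∈ posPairs n | R - 1 < p.1.gcd (n - p.1 - p.2)} ∪
        {p ∈ posPairs n | R - 1 < p.2.gcd (n - p.1 - p.2)})))) ∪
      {p ∈ posPairs n | 8 * n < 25 * p.1 ∧ 8 * n < 25 * p.2 ∧ 8 * n < 25 * (n - p.1 - p.2)} := by
    rintro ⟨a, b⟩ hp
    obtain ⟨hpos, hbad⟩ := mem_filter.mp hp
    simp only [mem_union, mem_filter, hpos, true_and] at hbad ⊢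
    by_contra! hcon
    obtain ⟨⟨⟨h1, h2, h3, h4⟩, h5, h6, h7, h8⟩, h9⟩ := hcon
    rw [mem_posPairs] at hpos
    simp only at hpos
    have hsum : a + b + (n - a - b) = n := by omega
    refine hbad ⟨fun d ha hb hc => ?_, ?_, ?_, ?_, ?_, ⟨by omega, by omega, by omega⟩, ?_⟩
    · by_contra hd
      have hq := Nat.minFac_dvd d
      have hdn : d ∣ n := hsum ▸ (ha.add hb).add hc
      exact h1 d.minFac (Nat.mem_primeFactors.mpr ⟨Nat.minFac_prime hd, hq.trans hdn, hn.ne'⟩)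
        (hq.trans ha) (hq.trans hb)
    · rwa [hsum]
    · rwa [hsum]
    · rwa [hsum]
    · simp only [← not_lt]
      obtain ⟨h51, h52, h53⟩ := h5
      simp only [← not_lt] at h51 h52 h53
      tauto
    · rw [hsum]
      by_contra! hcon
      have := h9 hcon.1 hcon.2.1
      omega
  have hcard := card_le_card hsub
  have hu := fun s t : Finset (ℕ × ℕ) => card_union_le s t
  refine (Nat.mul_le_mul_left 2 (hcard.trans ((hu _ _).trans (Nat.add_le_add_right ((hu _ _).trans
    (add_le_add ((hu _ _).trans (Nat.add_le_add_left ((hu _ _).trans (Nat.add_le_add_left (hu _ _)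
    _)) _)) ((hu _ _).trans (Nat.add_le_add_left ((hu _ _).trans (Nat.add_le_add_left (hu _ _)
    _)) _)))) _)))).trans ?_
  have a1 := card_posPairs_filter_fst_third_le n fun x y => (x + y) / x.gcd y ∣ n
  have a2 := card_posPairs_filter_snd_third_le n fun x y => (x + y) / x.gcd y ∣ n
  have b1 := card_posPairs_filter_fst_third_le n fun x y => R - 1 < x.gcd y
  have b2 := card_posPairs_filter_snd_third_le n fun x y => R - 1 < x.gcd y
  have c1 := card_posPairs_filter_fst_third_le n fun x y => min x y < R * x.gcd y
  have c2 := card_posPairs_filter_snd_third_le n fun x y => min x y < R * x.gcd y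
  have c3 := two_mul_card_two_of_three_le (posPairs n) (fun p => min p.1 p.2 < R * p.1.gcd p.2)
    (fun p => min p.1 (n - p.1 - p.2) < R * p.1.gcd (n - p.1 - p.2))
    fun p => min p.2 (n - p.1 - p.2) < R * p.2.gcd (n - p.1 - p.2)
  have e := card_posPairs_balanced_le n
  omega

theorem counting_bound {n R H : ℕ} (hn : 0 < n) (hR : 2 ≤ R) (hH : 0 < H) {S : Finset ℕ}
    (hS : ∀ k ∈ S, 0 < k ∧ k < n ∧ n - k ∈ S) (hSn : 2 * #S + 2 ≤ n)
    (hhit : ∀ a b c, 0 < a → 0 < b → 0 < c → a + b + c = n → IsGoodTriple R a b c →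
      a ∈ S ∨ b ∈ S ∨ c ∈ S) :
    ((n : ℝ) - 1 - #S) * (n - 2 - 2 * #S) ≤ (n : ℝ) ^ 2 * (1 - 6 / Real.pi ^ 2) +
      6 * (n * (2 * √n)) + 3 * (2 * R * n * (1 + Real.log H) + (n : ℝ) ^ 2 / (2 * H)) +
      3 * ((n : ℝ) ^ 2 / (R - 1)) + 2 * (n / 25 + 1) ^ 2 := by
  classical
  have h0 := le_two_mul_card_avoiding hS hSn
  have h1 : #{p ∈ posPairs n | p.1 ∉ S ∧ p.2 ∉ S ∧ n - p.1 - p.2 ∉ S} ≤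
      #{p ∈ posPairs n | ¬ IsGoodTriple R p.1 p.2 (n - p.1 - p.2)} := by
    refine card_le_card fun p hp => ?_
    simp only [mem_filter, mem_posPairs] at hp ⊢
    refine ⟨hp.1, fun hgood => ?_⟩
    have := hhit _ _ _ hp.1.1 hp.1.2.1 (by omega) (by omega) hgood
    tauto
  have h2 := h0.trans ((Nat.mul_le_mul_left 2 h1).trans (card_not_isGoodTriple_le hn (by omega)))
  have h3 : (((n - 1 - #S) * (n - 2 - 2 * #S) : ℕ) : ℝ) =
      ((n : ℝ) - 1 - #S) * (n - 2 - 2 * #S) := by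
    rw [Nat.sub_sub, Nat.sub_sub, Nat.cast_mul, Nat.cast_sub (by omega), Nat.cast_sub (by omega)]
    push_cast
    ring
  have h4 : ((n / 25 + 1 : ℕ) : ℝ) ≤ n / 25 + 1 := by
    push_cast
    gcongr
    exact_mod_cast Nat.cast_div_le (α := ℝ) (m := n) (n := 25)
  have h4' : ((n / 25 + 1 : ℕ) : ℝ) ^ 2 ≤ (n / 25 + 1) ^ 2 := by gcongr
  have h5 := two_mul_card_posPairs_common_prime_le hn
  have h6 : (#{p ∈ posPairs n | (p.1 + p.2) / p.1.gcd p.2 ∣ n} : ℝ) ≤ n * (2 * √n) := by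
    refine (Nat.cast_le.mpr (card_posPairs_div_gcd_dvd_le hn)).trans ?_
    rw [Nat.cast_mul]
    gcongr
    have := Nat.card_divisors_sq_le n
    have h : (#n.divisors : ℝ) ^ 2 ≤ (2 * √n) ^ 2 := by
      rw [mul_pow, Real.sq_sqrt n.cast_nonneg]
      norm_num
      exact_mod_cast this
    exact (pow_le_pow_iff_left₀ (by positivity) (by positivity) two_ne_zero).mp h
  have h7 := card_posPairs_min_lt_le (R := R) hn hH
  have h8 := card_posPairs_lt_gcd_le (H := R - 1) hn (by omega)
  rw [Nat.cast_sub (by omega), Nat.cast_one] at h8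
  have h9 : (n : ℝ) ^ 2 / (2 * (R - 1)) = (n : ℝ) ^ 2 / (R - 1) / 2 := by
    rw [div_div, mul_comm 2]
  rw [h9] at h8
  have h10 : (((n - 1 - #S) * (n - 2 - 2 * #S) : ℕ) : ℝ) ≤
      2 * #{p ∈ posPairs n | ∃ q ∈ n.primeFactors, q ∣ p.1 ∧ q ∣ p.2} +
      6 * #{p ∈ posPairs n | (p.1 + p.2) / p.1.gcd p.2 ∣ n} +
      3 * #{p ∈ posPairs n | min p.1 p.2 < R * p.1.gcd p.2} +
      6 * #{p ∈ posPairs n | R - 1 < p.1.gcd p.2} + 2 * ((n / 25 + 1 : ℕ) : ℝ) ^ 2 := by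
    exact_mod_cast h2
  rw [h3] at h10
  linarith

theorem sqrt_one_sub_four_div_pi_sq_mem :
    0.771 ≤ √(1 - 4 / Real.pi ^ 2) ∧ √(1 - 4 / Real.pi ^ 2) ≤ 0.7712 ∧
      √(1 - 4 / Real.pi ^ 2) ^ 2 = 1 - 4 * (1 / Real.pi ^ 2) ∧ 1 / Real.pi ^ 2 ≤ 0.10134 := by
  have h1 : 3.1415 ^ 2 ≤ Real.pi ^ 2 := by gcongr; exact Real.pi_gt_d4.le
  have h2 : Real.pi ^ 2 ≤ 3.1416 ^ 2 := by gcongr; exact Real.pi_lt_d4.le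
  have h0 : 0 < Real.pi ^ 2 := by positivity
  have h3 : 1 / Real.pi ^ 2 ≤ 0.10134 := by rw [div_le_iff₀ h0]; linarith
  have h4 : 0.10132 ≤ 1 / Real.pi ^ 2 := by rw [le_div_iff₀ h0]; linarith
  have h5 : 4 / Real.pi ^ 2 = 4 * (1 / Real.pi ^ 2) := by ring
  rw [h5]
  refine ⟨Real.le_sqrt_of_sq_le (by linarith), ?_, Real.sq_sqrt (by linarith), h3⟩
  rw [Real.sqrt_le_left (by norm_num)]
  linarith

theorem polynomial_bound {u : ℝ} (hu : 2.62 ≤ u) :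
    9.6 * u ^ 20 + 40 * u ^ 12 + 21 * u ^ 13 + 3.75 * u ^ 16 < 3.2 * u ^ 21 + 22 * u ^ 18 := by
  have h1 : 3.75 * u ^ 16 ≤ 0.55 * u ^ 18 := by
    have h : 2.62 ^ 2 ≤ u ^ 2 := by gcongr
    rw [show u ^ 18 = u ^ 2 * u ^ 16 by ring, ← mul_assoc]
    gcongr
    linarith
  have h2 : 21 * u ^ 13 + 40 * u ^ 12 ≤ 0.5 * u ^ 18 := by
    have : 2.62 ^ 5 ≤ u ^ 5 := by gcongr
    have h12 : 0 < u ^ 12 := by positivity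
    have : 21 * u + 40 ≤ 0.5 * u ^ 6 := by nlinarith
    nlinarith
  have h3 : 9.6 * u ^ 2 < 3.2 * u ^ 3 + 20.9 := by nlinarith [sq_nonneg (u - 2), sq_nonneg u]
  nlinarith [pow_pos (by linarith : 0 < u) 18]

theorem main_term_lt {u α c p : ℝ} (hu : 2.62 ≤ u) (hα : 0.771 ≤ α) (hα' : α ≤ 0.7712)
    (hαp : α ^ 2 = 1 - 4 * p) (hp : p ≤ 0.10134) (hc : 4.123 ≤ c) (hc2 : c ^ 2 = 17) :
    u ^ 24 * (1 - 6 * p) + 12 * u ^ 18 + 6 * (0.8 * u ^ 8 + 3) * u ^ 12 * (2 + 1.12 * u) +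
        3.75 * u ^ 16 + 2 * (u ^ 12 / 25 + 1) ^ 2 <
      (α * u ^ 12 + c * u ^ 9) * ((2 * α - 1) * u ^ 12 + 2 * c * u ^ 9) - 3 * u ^ 12 := by
  have hAB : (α * u ^ 12 + c * u ^ 9) * ((2 * α - 1) * u ^ 12 + 2 * c * u ^ 9) =
      (2 * (1 - 4 * p) - α) * u ^ 24 + (4 * α - 1) * c * u ^ 21 + 34 * u ^ 18 := by
    rw [← hαp, show (34 : ℝ) = 2 * 17 by norm_num, ← hc2]
    ring
  rw [hAB]
  have h1 : 8.59 * u ^ 21 ≤ (4 * α - 1) * c * u ^ 21 := by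
    gcongr
    nlinarith
  have h2 : 0.0226 * u ^ 24 ≤ (1 - 2 * p - α - 0.0032) * u ^ 24 := by
    gcongr
    linarith
  have h3 : 1 ≤ u ^ 24 := one_le_pow₀ (by linarith)
  have h5 : 2.62 ^ 12 ≤ u ^ 12 := by gcongr
  have h6 : 200 ≤ u ^ 24 := by
    calc (200 : ℝ) ≤ 2.62 ^ 24 := by norm_num
      _ ≤ u ^ 24 := by gcongr
  have h4 := polynomial_bound hu
  have h7 : 0 < u ^ 21 := by positivity
  have h8 : 0 < u ^ 13 := by positivity
  ring_nf at h1 h2 h4 ⊢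
  linarith

theorem log_le_of_le {H u : ℝ} (hu : 2.62 ≤ u) (hH : 0 < H) (hHu : H ≤ 0.3125 * u ^ 4 + 1) :
    Real.log H ≤ 1.12 * u := by
  have h1 : H ≤ (0.761 * u) ^ 4 := by
    have : 2.62 ^ 4 ≤ u ^ 4 := by gcongr
    have h : 0.335 * u ^ 4 ≤ (0.761 * u) ^ 4 := by
      rw [mul_pow]
      gcongr
      norm_num
    linarith
  have hv : 0 < 0.761 * u := by linarith
  have h2 := Real.log_le_log hH h1
  rw [Real.log_pow] at h2
  have he := Real.exp_pos 1
  have h3 := Real.log_le_sub_one_of_pos (div_pos hv he)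
  rw [Real.log_div hv.ne' he.ne', Real.log_exp] at h3
  have h4 : 0.761 * u / Real.exp 1 ≤ 0.28 * u := by
    rw [div_le_iff₀ he]
    nlinarith [Real.exp_one_gt_d9]
  push_cast at h2
  linarith

theorem exists_parameters {n : ℕ} {σ : ℝ} (h0 : 0 ≤ σ)
    (hσ : σ < n * (1 - √(1 - 4 / Real.pi ^ 2)) - √17 * (n : ℝ) ^ ((3 : ℝ) / 4)) :
    100000 ≤ n ∧ 2 * σ + 2 ≤ n ∧ ∃ R H : ℕ, 2 ≤ R ∧ 0 < H ∧ 25 * (n : ℝ) ≤ (R : ℝ) ^ 2 ∧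
      512 * (n : ℝ) ^ 2 ≤ 1000 * ((R : ℝ) ^ 2 * (R - 2)) ∧
      (n : ℝ) ^ 2 * (1 - 6 / Real.pi ^ 2) + 6 * (n * (2 * √n)) +
          3 * (2 * R * n * (1 + Real.log H) + (n : ℝ) ^ 2 / (2 * H)) +
          3 * ((n : ℝ) ^ 2 / (R - 1)) + 2 * (n / 25 + 1) ^ 2 <
        ((n : ℝ) - 1 - σ) * (n - 2 - 2 * σ) := by
  obtain ⟨hα, hα', hαp, hp⟩ := sqrt_one_sub_four_div_pi_sq_mem
  have hc : 4.123 ≤ √17 := Real.le_sqrt_of_sq_le (by norm_num)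
  have hc2 : √17 ^ 2 = 17 := Real.sq_sqrt (by norm_num)
  have hn0 : 0 < n := by
    by_contra! h
    obtain rfl : n = 0 := by omega
    norm_num at hσ
    linarith
  have hN0 : (0 : ℝ) < n := by exact_mod_cast hn0
  obtain ⟨u, hu0, hun, hu9, hu6⟩ : ∃ u : ℝ, 0 < u ∧ (n : ℝ) = u ^ 12 ∧
      (n : ℝ) ^ ((3 : ℝ) / 4) = u ^ 9 ∧ √n = u ^ 6 := by
    refine ⟨(n : ℝ) ^ ((1 : ℝ) / 12), by positivity, ?_, ?_, ?_⟩
    · rw [← Real.rpow_natCast, ← Real.rpow_mul hN0.le]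
      norm_num
    · rw [← Real.rpow_natCast, ← Real.rpow_mul hN0.le]
      norm_num
    · rw [← Real.rpow_natCast, ← Real.rpow_mul hN0.le, Real.sqrt_eq_rpow]
      norm_num
  have hp6 : 6 / Real.pi ^ 2 = 6 * (1 / Real.pi ^ 2) := by ring
  rw [hp6]
  generalize √(1 - 4 / Real.pi ^ 2) = α at *
  generalize 1 / Real.pi ^ 2 = p at *
  generalize √17 = c at *
  rw [hu9, hun] at hσ
  have hu9' : 0 < u ^ 9 := by positivity
  have hu3 : 18 < u ^ 3 := by
    by_contra! h
    have h1 : u ^ 12 * (1 - α) ≤ 18 * u ^ 9 * (1 - 0.771) := by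
      rw [show u ^ 12 = u ^ 3 * u ^ 9 by ring]
      gcongr
      linarith
    have h2 : 4.123 * u ^ 9 ≤ c * u ^ 9 := by gcongr
    linarith
  have hu : 2.62 ≤ u := by
    by_contra! h
    have : u ^ 3 ≤ 2.62 ^ 3 := by gcongr
    linarith
  have hu12 : 2.62 ^ 12 ≤ u ^ 12 := by gcongr
  have hu4 : 2.62 ^ 4 ≤ u ^ 4 := by gcongr
  have hu8 : 2.62 ^ 8 ≤ u ^ 8 := by gcongr
  have hR0 := Nat.le_ceil (0.8 * u ^ 8)
  have hR1 := Nat.ceil_lt_add_one (a := 0.8 * u ^ 8) (by positivity)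
  obtain ⟨R, hR, hRl, hRu⟩ : ∃ R : ℕ, 2 ≤ R ∧ 0.8 * u ^ 8 + 2 ≤ R ∧ R ≤ 0.8 * u ^ 8 + 3 := by
    refine ⟨⌈0.8 * u ^ 8⌉₊ + 2, by omega, ?_, ?_⟩ <;> push_cast <;> linarith
  have hRpos : (0 : ℝ) < R := by linarith
  have hH0 := Nat.le_ceil (u ^ 12 / (4 * R))
  have hH1 := Nat.ceil_lt_add_one (a := u ^ 12 / (4 * R)) (by positivity)
  have hHpos : 0 < ⌈u ^ 12 / (4 * R)⌉₊ := Nat.ceil_pos.mpr (by positivity)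
  generalize ⌈u ^ 12 / (4 * R)⌉₊ = H at *
  have hHpos' : (0 : ℝ) < H := by exact_mod_cast hHpos
  have hlog : Real.log H ≤ 1.12 * u := by
    refine log_le_of_le hu hHpos' (hH1.le.trans ?_)
    gcongr ?_ + 1
    rw [div_le_iff₀ (by positivity)]
    calc u ^ 12 = 0.3125 * u ^ 4 * (4 * (0.8 * u ^ 8)) := by ring
      _ ≤ 0.3125 * u ^ 4 * (4 * R) := by gcongr; linarith
  have hA : α * u ^ 12 + c * u ^ 9 ≤ u ^ 12 - σ := by linarith
  have hB : (2 * α - 1) * u ^ 12 + 2 * c * u ^ 9 ≤ u ^ 12 - 2 * σ := by linarith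
  have hA0 : 0 ≤ α * u ^ 12 + c * u ^ 9 := by positivity
  have hB2 : 2 ≤ (2 * α - 1) * u ^ 12 + 2 * c * u ^ 9 := by
    have : 0.542 * u ^ 12 ≤ (2 * α - 1) * u ^ 12 := by gcongr; linarith
    have : 0 ≤ 2 * c * u ^ 9 := by positivity
    linarith
  refine ⟨?_, by rw [hun]; linarith, R, H, hR, hHpos, ?_, ?_, ?_⟩
  · have : (100000 : ℝ) ≤ n := by rw [hun]; linarith
    exact_mod_cast this
  · rw [hun]
    have : (0.8 * u ^ 8) ^ 2 ≤ (R : ℝ) ^ 2 := by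
      gcongr
      linarith
    have h : 25 * u ^ 12 ≤ 0.64 * u ^ 4 * u ^ 12 := by
      gcongr
      linarith
    linarith
  · rw [hun]
    have h1 : (0.8 * u ^ 8) ^ 2 ≤ (R : ℝ) ^ 2 := by
      gcongr
      linarith
    have h2 : (0.8 * u ^ 8) ^ 2 * (0.8 * u ^ 8) ≤ (R : ℝ) ^ 2 * (R - 2) := by
      gcongr
      linarith
    linarith
  · rw [hu6, hun]
    have h1 : (u ^ 12) ^ 2 / (2 * H) ≤ 2 * R * u ^ 12 := by
      rw [div_le_iff₀ (by positivity)] at hH0 ⊢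
      calc (u ^ 12) ^ 2 = u ^ 12 * u ^ 12 := sq _
        _ ≤ u ^ 12 * (H * (4 * R)) := by gcongr
        _ = 2 * R * u ^ 12 * (2 * H) := by ring
    have h2 : (u ^ 12) ^ 2 / (R - 1) ≤ 1.25 * u ^ 16 := by
      rw [div_le_iff₀ (by linarith)]
      calc (u ^ 12) ^ 2 = 1.25 * u ^ 16 * (0.8 * u ^ 8) := by ring
        _ ≤ 1.25 * u ^ 16 * (R - 1) := by gcongr; linarith
    have h3 : 2 * R * u ^ 12 * (2 + Real.log H) ≤
        2 * (0.8 * u ^ 8 + 3) * u ^ 12 * (2 + 1.12 * u) := by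
      have : 0 ≤ Real.log H := Real.log_natCast_nonneg H
      gcongr
    have h4 := main_term_lt hu hα hα' hαp hp hc hc2
    have h5 : (α * u ^ 12 + c * u ^ 9) * ((2 * α - 1) * u ^ 12 + 2 * c * u ^ 9) ≤
        (u ^ 12 - σ) * (u ^ 12 - 2 * σ) := mul_le_mul hA hB (by linarith) (by linarith)
    have h6 : u ^ 24 = (u ^ 12) ^ 2 := by ring
    have h7 : u ^ 18 = u ^ 12 * u ^ 6 := by ring
    rw [h6, h7] at h4
    linarith

end

section

open Equiv Equiv.Perm Finset

theorem normalCoveringNumber_spec (G : Type*) [Group G] [Finite G] (hG : ¬ IsCyclic G) :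
    ∃ H : Fin (normalCoveringNumber G) → Subgroup G, (∀ i, H i ≠ ⊤) ∧
      ∀ g : G, ∃ i, ∃ x : G, x * g * x⁻¹ ∈ H i := by
  refine Nat.sInf_mem (s := {s : ℕ | ∃ H : Fin s → Subgroup G, (∀ i, H i ≠ ⊤) ∧
    ∀ g : G, ∃ i : Fin s, ∃ x : G, x * g * x⁻¹ ∈ H i})
    ⟨Nat.card G, fun i => Subgroup.zpowers ((Finite.equivFin G).symm i), fun i hi => ?_,
      fun g => ⟨Finite.equivFin G g, 1, ?_⟩⟩
  · exact hG ((isCyclic_iff_exists_zpowers_eq_top).mpr ⟨_, hi⟩)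
  · simp

theorem le_of_forall_hasThreeCycles {n s : ℕ} (L : Fin s → Subgroup (Perm (Fin n)))
    (hL : ∀ (g : Perm (Fin n)) (x y z : Fin n), HasThreeCycles g x y z →
      sign g = (-1) ^ (n + 1) →
      ∃ i, ∃ t : Perm (Fin n), t * g * t⁻¹ ∈ L i ∧ ¬ alternatingGroup (Fin n) ≤ L i) :
    (n / 2) * (1 - √(1 - 4 / Real.pi ^ 2)) - (√17 / 2) * (n : ℝ) ^ ((3 : ℝ) / 4) ≤ s := by
  by_contra! hs
  obtain ⟨hn, hsn, R, H, hR, hH, hR1, hR2, hlt⟩ :=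
    exists_parameters (n := n) (σ := (2 * s : ℕ)) (Nat.cast_nonneg _) (by push_cast; linarith)
  obtain ⟨S, hS, hS', hhit⟩ := exists_hitting_set hn hR1 hR2 L hL
  have hS2 : (#S : ℝ) ≤ (2 * s : ℕ) := by exact_mod_cast hS
  have hSn : 2 * #S + 2 ≤ n := by
    have : 2 * (2 * s) + 2 ≤ n := by exact_mod_cast hsn
    omega
  have hcount := counting_bound (by omega) hR hH hS' hSn hhit
  have hmono : ((n : ℝ) - 1 - (2 * s : ℕ)) * (n - 2 - 2 * (2 * s : ℕ)) ≤
      (n - 1 - #S) * (n - 2 - 2 * #S) := by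
    have h0 : (0 : ℝ) ≤ (2 * s : ℕ) := Nat.cast_nonneg _
    exact mul_le_mul (by linarith) (by linarith) (by linarith) (by linarith)
  exact (hlt.trans_le hmono).not_ge hcount

theorem normalCoveringNumber_perm_ge {n : ℕ} (hn : 3 ≤ n) (he : Even n) :
    (n / 2) * (1 - √(1 - 4 / Real.pi ^ 2)) - (√17 / 2) * (n : ℝ) ^ ((3 : ℝ) / 4) ≤
      normalCoveringNumber (Perm (Fin n)) := by
  obtain ⟨H, hH, hcov⟩ := normalCoveringNumber_spec (Perm (Fin n)) fun h => by
    have := isMulCommutative_iff_card_le_two.mp h.isMulCommutative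
    simp at this
    omega
  refine le_of_forall_hasThreeCycles H fun g x y z _ hg => ?_
  obtain ⟨i, t, ht⟩ := hcov g
  refine ⟨i, t, ht, fun hA => hH i (eq_top_iff.mpr fun u _ => ?_)⟩
  rw [he.add_one.neg_one_pow] at hg
  rcases Int.units_eq_one_or (sign u) with hu | hu
  · exact hA (mem_alternatingGroup.mpr hu)
  · have : u * (t * g * t⁻¹)⁻¹ ∈ H i := hA (mem_alternatingGroup.mpr (by simp [hu, hg]))
    simpa only [inv_mul_cancel_right] using mul_mem this ht

theorem normalCoveringNumber_alternatingGroup_ge {n : ℕ} (hn : 4 ≤ n) (ho : Odd n) :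
    (n / 2) * (1 - √(1 - 4 / Real.pi ^ 2)) - (√17 / 2) * (n : ℝ) ^ ((3 : ℝ) / 4) ≤
      normalCoveringNumber (alternatingGroup (Fin n)) := by
  obtain ⟨H, hH, hcov⟩ := normalCoveringNumber_spec (alternatingGroup (Fin n)) fun h => by
    have := alternatingGroup.isMulCommutative_iff_card_le_three.mp h.isMulCommutative
    simp at this
    omega
  refine le_of_forall_hasThreeCycles
    (fun i => (H i).map (alternatingGroup (Fin n)).subtype) fun g x y z _ hg => ?_
  rw [ho.add_one.neg_one_pow] at hg
  obtain ⟨i, t, ht⟩ := hcov ⟨g, mem_alternatingGroup.mpr hg⟩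
  refine ⟨i, t, ⟨_, ht, rfl⟩, fun hA => hH i (eq_top_iff.mpr fun u _ => ?_)⟩
  obtain ⟨v, hv, hvu⟩ := hA u.2
  rwa [← Subtype.ext hvu]

end

theorem gamma_lower_bound_pi (n : ℕ) (hn : 20 ≤ n) :
    (Even n →
      (normalCoveringNumber (Equiv.Perm (Fin n)) : ℝ) ≥
        (n / 2) * (1 - Real.sqrt (1 - 4 / Real.pi ^ 2)) -
          (Real.sqrt 17 / 2) * (n : ℝ) ^ ((3 : ℝ) / 4)) ∧
    (Odd n →
      (normalCoveringNumber (alternatingGroup (Fin n)) : ℝ) ≥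
        (n / 2) * (1 - Real.sqrt (1 - 4 / Real.pi ^ 2)) -
          (Real.sqrt 17 / 2) * (n : ℝ) ^ ((3 : ℝ) / 4)) := by
  exact ⟨fun he => normalCoveringNumber_perm_ge (by omega) he,
    fun ho => normalCoveringNumber_alternatingGroup_ge (by omega) ho⟩
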